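/- There exist β > 0 and an integer n₀ such that the following holds. Let n > n₀ be an even integer and let H be a 3-graph on n vertices with δ₁(H) ≥ C(n−1,2) − C(⌊3n/4⌋,2) + c, where c = 2 if n is divisible by 4 and c = 1 otherwise. If H is β-extremal, then H contains a loose Hamilton cycle. -/

import Mathlib

/-- The degree of a vertex in a 3-graph: the number of edges containing it. -/
def hdeg {α : Type*} [DecidableEq α] (H : Finset (Finset α)) (v : α) : ℕ :=
  (H.filter (fun e => v ∈ e)).card

/-- The number of edges of `H` contained in the vertex set `B`. -/
def eIn {α : Type*} [DecidableEq α] (H : Finset (Finset α)) (B : Finset α) : ℕ :=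
  (H.filter (fun e => e ⊆ B)).card

/-- A 3-graph on `n` vertices is `β`-extremal if some vertex set `B` of size `⌊3n/4⌋`
spans at most `β n³` edges. -/
def BetaExtremal (β : ℝ) (n : ℕ) (H : Finset (Finset (Fin n))) : Prop :=
  ∃ B : Finset (Fin n), B.card = 3 * n / 4 ∧ (eIn H B : ℝ) ≤ β * (n : ℝ) ^ 3

/-- A 3-graph on vertex set `Fin n` contains a loose Hamilton cycle. -/
def HasLooseHamCycle (n : ℕ) (H : Finset (Finset (Fin n))) : Prop :=
  ∃ f : ZMod n → Fin n, Function.Bijective f ∧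
    ∀ i : ℕ, i < n / 2 →
      ({f ((2 * i : ℕ) : ZMod n), f ((2 * i + 1 : ℕ) : ZMod n),
        f ((2 * i + 2 : ℕ) : ZMod n)} : Finset (Fin n)) ∈ H

section LoosePaths

variable {α : Type*} [DecidableEq α]

/-- The list `l` traces a loose path of `H`: its length is odd, and each three consecutive
entries starting at an even index form an edge. -/
def IsLoosePath (H : Finset (Finset α)) : List α → Prop
  | a :: b :: c :: l => ({a, b, c} : Finset α) ∈ H ∧ IsLoosePath H (c :: l)
  | [_] => True
  | _ => False

theorem IsLoosePath.append {H : Finset (Finset α)} {c : α} {l₂ : List α} :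
    ∀ {l₁ : List α}, IsLoosePath H (l₁ ++ [c]) → IsLoosePath H (c :: l₂) →
      IsLoosePath H (l₁ ++ c :: l₂)
  | [], _, h₂ => h₂
  | [_], h₁, _ => by simp [IsLoosePath] at h₁
  | [_, _], h₁, h₂ => by
      simp only [List.cons_append, List.nil_append, IsLoosePath] at h₁ ⊢
      exact ⟨h₁.1, h₂⟩
  | _ :: _ :: d :: l, h₁, h₂ => by
      simp only [List.cons_append, IsLoosePath] at h₁ ⊢
      exact ⟨h₁.1, IsLoosePath.append (l₁ := d :: l) h₁.2 h₂⟩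

theorem IsLoosePath.getD_mem {H : Finset (Finset α)} (x : α) :
    ∀ {l : List α} {i : ℕ}, IsLoosePath H l → 2 * i + 2 < l.length →
      ({l.getD (2 * i) x, l.getD (2 * i + 1) x, l.getD (2 * i + 2) x} : Finset α) ∈ H
  | a :: b :: c :: l, 0, h, _ => by simpa using h.1
  | a :: b :: c :: l, i + 1, h, hi => by
      have := IsLoosePath.getD_mem x (i := i) h.2 (by simp at hi ⊢; omega)
      simpa [mul_add] using this
  | [_], _, _, hi => by simp at hi
  | [], _, _, hi => by simp at hi
  | [_, _], _, _, hi => by simp at hi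

end LoosePaths

theorem hasLooseHamCycle_of_list {n : ℕ} {H : Finset (Finset (Fin n))} (hn : Even n)
    {a : Fin n} {l : List (Fin n)} (hnd : (a :: l).Nodup) (hlen : (a :: l).length = n)
    (hl : IsLoosePath H (a :: l ++ [a])) : HasLooseHamCycle n H := by
  have hn0 : 0 < n := by rw [← hlen]; simp
  have : NeZero n := ⟨hn0.ne'⟩
  refine ⟨fun i => (a :: l ++ [a]).getD i.val a, ?_, ?_⟩
  · rw [Fintype.bijective_iff_injective_and_card]
    refine ⟨?_, by simp [ZMod.card]⟩
    intro i j hij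
    have hi := ZMod.val_lt i
    have hj := ZMod.val_lt j
    simp only at hij
    rw [List.getD_append _ _ _ _ (by omega), List.getD_append _ _ _ _ (by omega),
      List.getD_eq_getElem _ _ (by omega), List.getD_eq_getElem _ _ (by omega),
      hnd.getElem_inj_iff] at hij
    exact ZMod.val_injective n hij
  · intro i hi
    obtain ⟨k, rfl⟩ := hn
    have key := hl.getD_mem a (i := i) (by
      rw [List.length_append, hlen]; simp; omega)
    have e1 : ((2 * i : ℕ) : ZMod (k + k)).val = 2 * i := by
      rw [ZMod.val_natCast, Nat.mod_eq_of_lt (by omega)]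
    have e2 : ((2 * i + 1 : ℕ) : ZMod (k + k)).val = 2 * i + 1 := by
      rw [ZMod.val_natCast, Nat.mod_eq_of_lt (by omega)]
    have e3 : (a :: l ++ [a]).getD ((2 * i + 2 : ℕ) : ZMod (k + k)).val a =
        (a :: l ++ [a]).getD (2 * i + 2) a := by
      rcases lt_or_eq_of_le (show 2 * i + 2 ≤ k + k by omega) with h | h
      · rw [ZMod.val_natCast, Nat.mod_eq_of_lt h]
      · have : (a :: l ++ [a]).getD (k + k) a = a := by
          rw [List.getD_append_right _ _ _ _ (by omega), hlen]
          simp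
        rw [ZMod.val_natCast, h, Nat.mod_self, this]
        simp
    simp only [e1, e2, e3]
    exact key

section Hall

theorem exists_injective_of_dense {ι β : Type*} [Fintype ι] [DecidableEq β]
    (Y : Finset β) (r : ι → β → Prop) [∀ x y, Decidable (r x y)] (p : ℝ)
    (hc : Y.card = Fintype.card ι)
    (h₁ : ∀ x, ((Y.filter fun y => ¬ r x y).card : ℝ) ≤ p)
    (h₂ : ∀ y ∈ Y, p < ((Finset.univ.filter fun x => r x y).card : ℝ)) :
    ∃ f : ι → β, Function.Injective f ∧ ∀ x, f x ∈ Y ∧ r x (f x) := by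
  classical
  have := (Finset.all_card_le_biUnion_card_iff_exists_injective
    (fun x => Y.filter fun y => r x y)).1 ?_
  · obtain ⟨f, hf, h⟩ := this
    exact ⟨f, hf, fun x => by simpa using h x⟩
  intro s
  rcases s.eq_empty_or_nonempty with rfl | ⟨x, hx⟩
  · simp
  by_cases hs : (s.card : ℝ) ≤ Y.card - p
  · have h3 : Y.filter (fun y => r x y) ⊆ s.biUnion fun x => Y.filter fun y => r x y :=
      Finset.subset_biUnion_of_mem (fun x => Y.filter fun y => r x y) hx
    have h4 := Finset.card_le_card h3
    have h5 := Finset.card_filter_add_card_filter_not (s := Y) (fun y => r x y)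
    have h6 := h₁ x
    have h7 : ((Y.filter fun y => r x y).card : ℝ) + ((Y.filter fun y => ¬ r x y).card : ℝ)
      = Y.card := by exact_mod_cast h5
    have h8 : (s.card : ℝ) ≤ ((Y.filter fun y => r x y).card : ℝ) := by linarith
    exact (by exact_mod_cast h8 : s.card ≤ _).trans h4
  · have : s.biUnion (fun x => Y.filter fun y => r x y) = Y := by
      apply Finset.Subset.antisymm
      · intro y; simp +contextual
      · intro y hy
        by_contra hcon
        have h3 : s ⊆ Finset.univ.filter fun x => ¬ r x y := by
          intro z hz
          simp only [Finset.mem_filter, Finset.mem_univ, true_and]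
          intro hr
          exact hcon (Finset.mem_biUnion.2 ⟨z, hz, by simp [hy, hr]⟩)
        have h4 := Finset.card_le_card h3
        have h5 := Finset.card_filter_add_card_filter_not (s := Finset.univ) (fun x => r x y)
        have h6 := h₂ y hy
        rw [Finset.card_univ, ← hc] at h5
        have h7 : ((Finset.univ.filter fun x => r x y).card : ℝ)
          + ((Finset.univ.filter fun x => ¬ r x y).card : ℝ) = Y.card := by exact_mod_cast h5
        have h8 : (s.card : ℝ) ≤ ((Finset.univ.filter fun x => ¬ r x y).card : ℝ) := by
          exact_mod_cast h4
        linarith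
    rw [this, hc]
    exact Finset.card_le_univ s

end Hall

section Segments

variable {α : Type*} [DecidableEq α] {H : Finset (Finset α)}

/-- A block of a loose Hamilton cycle between two consecutive linking vertices: the list `l`
becomes a loose path of `H` when it is extended by `a` in front and `a'` behind, provided that
`a` forms an edge with the front pair and `a'` forms an edge with the back pair. -/
structure Segment (H : Finset (Finset α)) where
  l : List α
  front : α × α
  back : α × α
  path : ∀ a a', ({a, front.1, front.2} : Finset α) ∈ H →
    ({a', back.1, back.2} : Finset α) ∈ H → IsLoosePath H (a :: (l ++ [a']))

/-- The segment with three vertices. -/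
def Segment.cherry (H : Finset (Finset α)) (z w y : α) : Segment H where
  l := [z, w, y]
  front := (w, z)
  back := (w, y)
  path a a' h h' := by
    refine ⟨?_, ?_, trivial⟩
    · convert h using 2; exact Finset.pair_comm _ _
    · convert h' using 1; grind

/-- The segment with five vertices around an edge `{x, v, y}`. -/
def Segment.edge {u x v y u' : α} (h : ({x, v, y} : Finset α) ∈ H) : Segment H where
  l := [u, x, v, y, u']
  front := (x, u)
  back := (y, u')
  path a a' h₁ h₂ := by
    refine ⟨?_, h, ?_, trivial⟩
    · convert h₁ using 2; exact Finset.pair_comm _ _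
    · convert h₂ using 1; grind

/-- The segment with seven vertices around two edges that share the vertex `c`. -/
def Segment.double {u x v c v' y u' : α} (h : ({x, v, c} : Finset α) ∈ H)
    (h' : ({c, v', y} : Finset α) ∈ H) : Segment H where
  l := [u, x, v, c, v', y, u']
  front := (x, u)
  back := (y, u')
  path a a' h₁ h₂ := by
    refine ⟨?_, h, h', ?_, trivial⟩
    · convert h₁ using 2; exact Finset.pair_comm _ _
    · convert h₂ using 1; grind

/-- The number of vertices of `A` that form no edge with the pair `x, y`. -/
def pairMiss (H : Finset (Finset α)) (A : Finset α) (x y : α) : ℕ :=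
  (A.filter fun a => ({a, x, y} : Finset α) ∉ H).card

theorem pairMiss_mono {A A' : Finset α} (h : A ⊆ A') (x y : α) :
    pairMiss H A x y ≤ pairMiss H A' x y :=
  Finset.card_le_card (Finset.filter_subset_filter _ h)

/-- Both end pairs of the segment form edges with all but `c` vertices of `A`. -/
def Segment.Good (s : Segment H) (A : Finset α) (c : ℝ) : Prop :=
  (pairMiss H A s.front.1 s.front.2 : ℝ) ≤ c ∧ (pairMiss H A s.back.1 s.back.2 : ℝ) ≤ c

/-- The amount by which a block uses up more vertices of `B` than the balanced proportion. -/
def excess (B : Finset α) (l : List α) : ℤ :=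
  (l.countP (· ∈ B) : ℤ) - 3 * (l.countP (· ∉ B) : ℤ) - 3

theorem exists_cherries (R : Finset α) (r : ℕ) (hR : R.card = 3 * r) (g : α → α → Prop)
    [∀ x y, Decidable (g x y)] (p : ℝ) (hp : 2 * p < r)
    (hg : ∀ x ∈ R, ((R.filter fun y => ¬ g x y).card : ℝ) ≤ p) (hs : ∀ x y, g x y → g y x) :
    ∃ S : List (Segment H), S.length = r ∧ (S.flatMap Segment.l).Nodup ∧
      (S.flatMap Segment.l).toFinset = R ∧
      ∀ s ∈ S, ∃ z w y, s = Segment.cherry H z w y ∧ g w z ∧ g w y := by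
  obtain ⟨W, hWR, hW⟩ := Finset.exists_subset_card_eq (show r ≤ R.card by omega)
  have h1 := Finset.card_sdiff_of_subset hWR
  obtain ⟨Z, hZR, hZ⟩ := Finset.exists_subset_card_eq (show r ≤ (R \ W).card by omega)
  have h2 := Finset.card_sdiff_of_subset hZR
  have hall : ∀ T ⊆ R, T.card = r → ∃ f : W → α, Function.Injective f ∧
      ∀ x : W, f x ∈ T ∧ g x (f x) := by
    intro T hT hTc
    refine exists_injective_of_dense T (fun (x : W) y => g x y) p (by simp [hTc, hW]) ?_ ?_
    · intro x
      refine le_trans ?_ (hg x (hWR x.2))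
      exact_mod_cast Finset.card_le_card (Finset.filter_subset_filter _ hT)
    · intro y hy
      have e1 := hg y (hT hy)
      have e2 := Finset.card_filter_add_card_filter_not (s := W) (fun x => g x y)
      have e3 : (Finset.univ.filter fun x : W => g x y).card = (W.filter fun x => g x y).card := by
        rw [← Finset.card_map (Function.Embedding.subtype _)]
        congr 1
        ext x; simp [and_comm]
      have e4 : (W.filter fun x => ¬ g x y).card ≤ (R.filter fun x => ¬ g y x).card := by
        apply Finset.card_le_card
        intro x hx
        simp only [Finset.mem_filter] at hx ⊢
        exact ⟨hWR hx.1, fun h => hx.2 (hs _ _ h)⟩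
      have e5 : ((W.filter fun x => g x y).card : ℝ) + (W.filter fun x => ¬ g x y).card = r := by
        rw [← hW]; exact_mod_cast e2
      have e6 : ((W.filter fun x => ¬ g x y).card : ℝ) ≤ (R.filter fun x => ¬ g y x).card := by
        exact_mod_cast e4
      rw [e3]
      linarith
  obtain ⟨f, hf, hf'⟩ := hall Z (hZR.trans Finset.sdiff_subset) hZ
  obtain ⟨k, hk, hk'⟩ := hall ((R \ W) \ Z)
    (Finset.sdiff_subset.trans Finset.sdiff_subset) (by omega)
  have hfZ : ∀ x : W, f x ∈ R ∧ f x ∉ W := fun x => by simpa using hZR (hf' x).1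
  have hkY : ∀ x : W, k x ∈ R ∧ k x ∉ W ∧ k x ∉ Z := fun x => by
    have := (hk' x).1; simp at this; tauto
  have hfk : ∀ x y : W, f x ≠ k y := fun x y h => (hkY y).2.2 (h ▸ (hf' x).1)
  let S : List (Segment H) :=
    (Finset.univ : Finset W).toList.map fun w => Segment.cherry H (f w) w (k w)
  have hSl : S.length = r := by simp [S, hW]
  have hSf : S.flatMap Segment.l =
      (Finset.univ : Finset W).toList.flatMap fun w => [f w, w.1, k w] := by
    simp [S, List.flatMap_map, Segment.cherry]
  have hnd : (S.flatMap Segment.l).Nodup := by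
    rw [hSf, List.nodup_flatMap]
    constructor
    · intro w _
      have := (hfZ w).2
      have := (hkY w).2.1
      have := hfk w w
      simp only [List.nodup_cons, List.mem_cons, List.not_mem_nil, or_false, not_or,
        not_false_eq_true, List.nodup_nil, and_true]
      refine ⟨⟨?_, this⟩, ?_⟩
      · intro h; exact (hfZ w).2 (h ▸ w.2)
      · intro h; exact (hkY w).2.1 (h ▸ w.2)
    · refine (Finset.nodup_toList _).imp ?_
      intro a b hab
      have hab' : a.1 ≠ b.1 := fun h => hab (Subtype.ext h)
      have n1 : ∀ a b : W, f a ≠ b.1 := fun a b h => (hfZ a).2 (h ▸ b.2)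
      have n2 : ∀ a b : W, k a ≠ b.1 := fun a b h => (hkY a).2.1 (h ▸ b.2)
      have n3 : f a ≠ f b := fun h => hab (hf h)
      have n4 : k a ≠ k b := fun h => hab (hk h)
      simp only [Function.onFun, List.disjoint_cons_left, List.mem_cons, List.not_mem_nil,
        or_false, not_or, List.disjoint_nil_left, and_true]
      exact ⟨⟨n3, n1 a b, hfk a b⟩, ⟨(n1 b a).symm, hab', (n2 b a).symm⟩,
        (hfk b a).symm, n2 a b, n4⟩
  refine ⟨S, hSl, hnd, ?_, ?_⟩
  · apply Finset.eq_of_subset_of_card_le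
    · intro v hv
      rw [hSf] at hv
      simp only [List.mem_toFinset, List.mem_flatMap, List.mem_cons, List.not_mem_nil,
        or_false] at hv
      obtain ⟨w, -, rfl | rfl | rfl⟩ := hv
      · exact (hfZ w).1
      · exact hWR w.2
      · exact (hkY w).1
    · rw [List.toFinset_card_of_nodup hnd, hR, hSf]
      simp [List.length_flatMap, hW, mul_comm]
  · intro s hs
    simp only [S, List.mem_map] at hs
    obtain ⟨w, -, rfl⟩ := hs
    exact ⟨_, _, _, rfl, (hf' w).2, (hk' w).2⟩

theorem length_flatMap_le {S : List (Segment H)} {c : ℕ} (h : ∀ s ∈ S, s.l.length ≤ c) :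
    (S.flatMap Segment.l).length ≤ c * S.length := by
  rw [List.length_flatMap]
  refine (List.sum_le_card_nsmul _ c ?_).trans ?_
  · simpa using h
  · simp [mul_comm]

theorem exists_disjoint_segments {ι : Type*} [DecidableEq ι] (core : ι → Finset α)
    (Q : ι → Segment H → Prop) (B U : Finset α) (K : ℕ) (I : Finset ι)
    (hcore : ∀ i ∈ I, ∀ v ∈ core i, v ∉ B)
    (hdisj : ∀ i ∈ I, ∀ j ∈ I, i ≠ j → Disjoint (core i) (core j))
    (hU : ∀ i ∈ I, Disjoint (core i) U)
    (step : ∀ i ∈ I, ∀ U' : Finset α, U'.card ≤ K → Disjoint (core i) U' →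
      ∃ s : Segment H, Q i s ∧ s.l.Nodup ∧ s.l.length ≤ 7 ∧ Disjoint s.l.toFinset U' ∧
        ∀ v, v ∉ B → (v ∈ s.l ↔ v ∈ core i))
    (hK : U.card + 7 * I.card ≤ K) :
    ∃ S : List (Segment H), S.length = I.card ∧ (S.flatMap Segment.l).Nodup ∧
      (∀ v ∈ S.flatMap Segment.l, v ∉ U) ∧
      (∀ s ∈ S, s.l.length ≤ 7 ∧ ∃ i ∈ I, Q i s) ∧
      ∀ v, v ∉ B → (v ∈ S.flatMap Segment.l ↔ ∃ i ∈ I, v ∈ core i) := by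
  induction I using Finset.induction_on with
  | empty => exact ⟨[], by simp⟩
  | insert i I hi ih =>
    rw [Finset.card_insert_of_notMem hi] at hK
    obtain ⟨S, hS1, hS2, hS3, hS4, hS5⟩ := ih
      (fun j hj => hcore j (Finset.mem_insert_of_mem hj))
      (fun j hj k hk => hdisj j (Finset.mem_insert_of_mem hj) k (Finset.mem_insert_of_mem hk))
      (fun j hj => hU j (Finset.mem_insert_of_mem hj))
      (fun j hj => step j (Finset.mem_insert_of_mem hj)) (by omega)
    have hlen := length_flatMap_le (fun s hs => (hS4 s hs).1)
    obtain ⟨s, h1, h2, h3, h4, h5⟩ := step i (Finset.mem_insert_self _ _)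
      (U ∪ (S.flatMap Segment.l).toFinset)
      (by
        have := Finset.card_union_le U (S.flatMap Segment.l).toFinset
        have := List.toFinset_card_le (S.flatMap Segment.l)
        rw [hS1] at hlen
        omega)
      (by
        rw [Finset.disjoint_union_right]
        refine ⟨hU i (Finset.mem_insert_self _ _), Finset.disjoint_left.2 ?_⟩
        intro v hv hv'
        obtain ⟨j, hj, hvj⟩ := (hS5 v (hcore i (Finset.mem_insert_self _ _) v hv)).1
          (List.mem_toFinset.1 hv')
        exact Finset.disjoint_left.1 (hdisj i (Finset.mem_insert_self _ _) j
          (Finset.mem_insert_of_mem hj) (fun h => hi (h ▸ hj))) hv hvj)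
    rw [Finset.disjoint_union_right, Finset.disjoint_left, Finset.disjoint_left] at h4
    refine ⟨s :: S, by simp [hS1, Finset.card_insert_of_notMem hi], ?_, ?_, ?_, ?_⟩
    · rw [List.flatMap_cons, List.nodup_append']
      refine ⟨h2, hS2, ?_⟩
      intro v hv hv'
      exact h4.2 (List.mem_toFinset.2 hv) (List.mem_toFinset.2 hv')
    · intro v hv
      rw [List.flatMap_cons, List.mem_append] at hv
      rcases hv with hv | hv
      · exact h4.1 (List.mem_toFinset.2 hv)
      · exact hS3 v hv
    · intro t ht
      rcases List.mem_cons.1 ht with rfl | ht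
      · exact ⟨h3, i, Finset.mem_insert_self _ _, h1⟩
      · obtain ⟨h6, j, hj, h7⟩ := hS4 t ht
        exact ⟨h6, j, Finset.mem_insert_of_mem hj, h7⟩
    · intro v hv
      rw [List.flatMap_cons, List.mem_append, h5 v hv, hS5 v hv]
      simp

end Segments

section Closing

variable {α : Type*} [DecidableEq α] {H : Finset (Finset α)}

/-- The vertex `a` can link the segment `s` to the segment `t`. -/
def Links (H : Finset (Finset α)) (s t : Segment H) (a : α) : Prop :=
  ({a, t.front.1, t.front.2} : Finset α) ∈ H ∧ ({a, s.back.1, s.back.2} : Finset α) ∈ H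

instance (s t : Segment H) (a : α) : Decidable (Links H s t a) :=
  inferInstanceAs (Decidable (_ ∧ _))

theorem card_filter_not_links_le {s t : Segment H} {A : Finset α} {c : ℝ}
    (hs : s.Good A c) (ht : t.Good A c) :
    ((A.filter fun a => ¬ Links H s t a).card : ℝ) ≤ 2 * c := by
  have h : (A.filter fun a => ¬ Links H s t a).card ≤
      pairMiss H A t.front.1 t.front.2 + pairMiss H A s.back.1 s.back.2 := by
    refine le_trans (Finset.card_le_card ?_) (Finset.card_union_le _ _)
    intro a ha
    rw [Finset.mem_filter, Links] at ha
    simp only [Finset.mem_filter, Finset.mem_union]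
    tauto
  have h' : ((A.filter fun a => ¬ Links H s t a).card : ℝ) ≤
      pairMiss H A t.front.1 t.front.2 + pairMiss H A s.back.1 s.back.2 := by exact_mod_cast h
  linarith [hs.2, ht.1]

theorem exists_loose_cycle_of_segments (S : List (Segment H)) (hS : 0 < S.length)
    (d : Segment H) (A : Finset α) (hA : A.card = S.length) (hnd : (S.flatMap Segment.l).Nodup)
    (hdisj : ∀ v ∈ S.flatMap Segment.l, v ∉ A) (c : ℝ) (hgood : ∀ s ∈ S, s.Good A c)
    (hfit : ∀ a ∈ A, 2 * c < (((Finset.range (S.length - 1)).filter fun j =>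
      Links H (S.getD j d) (S.getD (j + 1) d) a).card : ℝ)) :
    ∃ a l, (a :: l).Nodup ∧ (a :: l).toFinset = A ∪ (S.flatMap Segment.l).toFinset ∧
      IsLoosePath H (a :: l ++ [a]) := by
  set K := S.length with hK
  have hmem : ∀ j < K, S.getD j d ∈ S := fun j hj => by
    rw [List.getD_eq_getElem _ _ hj]; exact List.getElem_mem _
  have hmod : ∀ j, j % K < K := fun j => Nat.mod_lt _ hS
  obtain ⟨f, hf, hf'⟩ := exists_injective_of_dense A
    (fun (i : Fin K) a => Links H (S.getD ((i + K - 1) % K) d) (S.getD i d) a) (2 * c)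
    (by simp [hA])
    (fun i => card_filter_not_links_le (hgood _ (hmem _ (hmod _))) (hgood _ (hmem _ i.2)))
    (by
      intro a ha
      refine (hfit a ha).trans_le ?_
      have : ((Finset.range (K - 1)).filter fun j =>
          Links H (S.getD j d) (S.getD (j + 1) d) a).card ≤ (Finset.univ.filter fun i : Fin K =>
            Links H (S.getD ((i + K - 1) % K) d) (S.getD i d) a).card := by
        refine Finset.card_le_card_of_injOn (fun j => ⟨(j + 1) % K, hmod _⟩) ?_ ?_
        · intro j hj
          simp only [Finset.coe_filter, Finset.mem_range, Set.mem_ofPred_eq, Finset.mem_univ,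
            true_and] at hj ⊢
          have e1 : (j + 1) % K = j + 1 := Nat.mod_eq_of_lt (by omega)
          have e2 : (j + 1 + K - 1) % K = j := by
            rw [show j + 1 + K - 1 = j + K by omega, Nat.add_mod_right,
              Nat.mod_eq_of_lt (by omega)]
          rw [e1, e2]
          exact hj.2
        · intro i hi j hj hij
          simp only [Finset.coe_filter, Finset.mem_range, Set.mem_ofPred_eq] at hi hj
          simp only [Fin.mk.injEq] at hij
          rw [Nat.mod_eq_of_lt (by omega), Nat.mod_eq_of_lt (by omega)] at hij
          omega
      exact_mod_cast this)
  let b : ℕ → α := fun j => f ⟨j % K, hmod j⟩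
  have hbA : ∀ j, b j ∈ A := fun j => (hf' _).1
  have hpath : ∀ j < K, IsLoosePath H (b j :: ((S.getD j d).l ++ [b (j + 1)])) := by
    intro j hj
    refine (S.getD j d).path _ _ ?_ ?_
    · have := (hf' ⟨j % K, hmod j⟩).2.1
      simpa only [b, Nat.mod_eq_of_lt hj] using this
    · have := (hf' ⟨(j + 1) % K, hmod _⟩).2.2
      have e : ((j + 1) % K + K - 1) % K = j := by
        rcases lt_or_eq_of_le (show j + 1 ≤ K from hj) with h | h
        · rw [Nat.mod_eq_of_lt h, show j + 1 + K - 1 = j + K by omega, Nat.add_mod_right,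
            Nat.mod_eq_of_lt hj]
        · rw [h, Nat.mod_self, Nat.mod_eq_of_lt (by omega)]; omega
      simpa only [e] using this
  have hind : ∀ j ≤ K, IsLoosePath H
      ((List.range j).flatMap (fun i => b i :: (S.getD i d).l) ++ [b j]) := by
    intro j
    induction j with
    | zero => intro _; simp [IsLoosePath]
    | succ j ih =>
      intro hj
      have := (ih (by omega)).append (hpath j hj)
      simpa [List.range_succ, List.flatMap_append] using this
  have hrange : (List.range K).map (fun i => S.getD i d) = S := by
    apply List.ext_getElem (by simp [hK])
    intro i h1 h2
    simp only [List.getElem_map, List.getElem_range]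
    exact List.getD_eq_getElem _ _ h2
  have hflat : (List.range K).flatMap (fun i => (S.getD i d).l) = S.flatMap Segment.l := by
    conv_rhs => rw [← hrange, List.flatMap_map]
  have hperm := List.map_append_flatMap_perm (List.range K) b (fun i => (S.getD i d).l)
  rw [hflat] at hperm
  have hbinj : ((List.range K).map b).Nodup := by
    refine List.Nodup.map_on ?_ List.nodup_range
    intro i hi j hj hij
    have := hf hij
    simp only [Fin.mk.injEq] at this
    rwa [Nat.mod_eq_of_lt (List.mem_range.1 hi), Nat.mod_eq_of_lt (List.mem_range.1 hj)] at this
  have hbsub : ((List.range K).map b).toFinset = A := by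
    apply Finset.eq_of_subset_of_card_le
    · intro v hv
      simp only [List.mem_toFinset, List.mem_map] at hv
      obtain ⟨i, -, rfl⟩ := hv
      exact hbA i
    · rw [List.toFinset_card_of_nodup hbinj, hA]; simp
  have hLnd : ((List.range K).map b ++ S.flatMap Segment.l).Nodup := by
    rw [List.nodup_append']
    refine ⟨hbinj, hnd, ?_⟩
    intro v hv hv'
    refine hdisj v hv' ?_
    rw [← hbsub]; exact List.mem_toFinset.2 hv
  obtain ⟨k, hk⟩ : ∃ k, K = k + 1 := ⟨K - 1, by omega⟩
  obtain ⟨l, hl⟩ : ∃ l, (List.range K).flatMap (fun i => b i :: (S.getD i d).l) = b 0 :: l := by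
    rw [hk, List.range_succ_eq_map, List.flatMap_cons]
    exact ⟨_, rfl⟩
  have hb : b K = b 0 := by simp [b]
  refine ⟨b 0, l, ?_, ?_, ?_⟩
  · rw [← hl]; exact hperm.nodup hLnd
  · rw [← hl, ← List.toFinset_eq_of_perm _ _ hperm, List.toFinset_append, hbsub]
  · have := hind K le_rfl
    rwa [hl, hb] at this

end Closing

section Assembly

variable {α : Type*} [DecidableEq α] {H : Finset (Finset α)}

theorem pairMiss_comm (A : Finset α) (x y : α) : pairMiss H A x y = pairMiss H A y x := by
  simp only [pairMiss, Finset.pair_comm]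

theorem ne_of_edge_mem (h3 : ∀ e ∈ H, e.card = 3) {x y z : α} (h : ({x, y, z} : Finset α) ∈ H) :
    x ≠ y ∧ x ≠ z ∧ y ≠ z := by
  have h := h3 _ h
  have h2 : ∀ a b : α, ({a, b} : Finset α).card ≠ 3 := fun a b hab =>
    absurd (hab ▸ Finset.card_le_two (a := a) (b := b)) (by norm_num)
  refine ⟨?_, ?_, ?_⟩ <;> rintro rfl
  · exact h2 _ _ (by simpa using h)
  · rw [Finset.pair_comm, Finset.insert_eq_of_mem (by simp)] at h
    exact h2 _ _ h
  · exact h2 _ _ (by simpa using h)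

/-- Every set of at most `K` vertices can be avoided by an edge through `v` whose other two
vertices lie in `B`. -/
def Rich (H : Finset (Finset α)) (B : Finset α) (v : α) (K : ℝ) : Prop :=
  ∀ U : Finset α, (U.card : ℝ) ≤ K →
    ∃ x ∈ B, ∃ y ∈ B, x ∉ U ∧ y ∉ U ∧ ({v, x, y} : Finset α) ∈ H

/-- Every vertex of `B` has, outside any set of at most `K` vertices, a partner in `B` with which
it misses at most `c` vertices of `A`. -/
def HasPartners (H : Finset (Finset α)) (A B : Finset α) (c K : ℝ) : Prop :=
  ∀ x ∈ B, ∀ U : Finset α, (U.card : ℝ) ≤ K →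
    ∃ u ∈ B, u ∉ U ∧ (pairMiss H A x u : ℝ) ≤ c

theorem HasPartners.mono {A B : Finset α} {c K K' : ℝ} (h : HasPartners H A B c K) (hK : K' ≤ K) :
    HasPartners H A B c K' :=
  fun x hx U hU => h x hx U (hU.trans hK)

theorem exists_double_segment (h3 : ∀ e ∈ H, e.card = 3) {A B : Finset α} {c K : ℝ}
    (hp : HasPartners H A B c K) {v : α} (hv : v ∉ B) (hr : Rich H B v K) (U : Finset α)
    (hU : (U.card : ℝ) + 6 ≤ K) (hvU : Disjoint {v} U) :
    ∃ s : Segment H, (s.Good A c ∧ excess B s.l = 0) ∧ s.l.Nodup ∧ s.l.length ≤ 7 ∧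
      Disjoint s.l.toFinset U ∧ ∀ x, x ∉ B → (x ∈ s.l ↔ x ∈ ({v} : Finset α)) := by
  have hvU' : v ∉ U := by simpa using hvU
  have hcard : ∀ (T : Finset α), T.card ≤ 6 → ((U ∪ T).card : ℝ) ≤ K := by
    intro T hT
    have h1 : ((U ∪ T).card : ℝ) ≤ U.card + T.card := by exact_mod_cast Finset.card_union_le U T
    have h2 : (T.card : ℝ) ≤ 6 := by exact_mod_cast hT
    linarith
  obtain ⟨x₁, hx₁, y₁, hy₁, hx₁U, hy₁U, h₁⟩ := hr (U ∪ ∅) (hcard _ (by simp))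
  obtain ⟨x₂, hx₂, y₂, hy₂, hx₂U, hy₂U, h₂⟩ := hr (U ∪ {x₁, y₁})
    (hcard _ (Finset.card_le_two.trans (by norm_num)))
  obtain ⟨u, hu, huU, hu'⟩ := hp x₁ hx₁ (U ∪ {x₁, y₁, x₂, y₂})
    (hcard _ (Finset.card_le_four.trans (by norm_num)))
  obtain ⟨t, ht, htU, ht'⟩ := hp y₂ hy₂ (U ∪ {u, x₁, y₁, x₂, y₂})
    (hcard _ (Finset.card_le_five.trans (by norm_num)))
  obtain ⟨a1, a2, a3⟩ := ne_of_edge_mem h3 h₁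
  obtain ⟨b1, b2, b3⟩ := ne_of_edge_mem h3 h₂
  simp only [Finset.mem_union, Finset.mem_insert, Finset.mem_singleton, not_or,
    Finset.notMem_empty, not_false_eq_true, and_true] at hx₁U hy₁U hx₂U hy₂U huU htU
  have huv : u ≠ v := fun h => hv (h ▸ hu)
  have htv : t ≠ v := fun h => hv (h ▸ ht)
  refine ⟨Segment.double (u := u) (x := x₁) (v := y₁) (c := v) (v' := x₂) (y := y₂) (u' := t)
    (by convert h₁ using 1; grind) h₂, ⟨⟨hu', ht'⟩, ?_⟩, ?_, by simp [Segment.double], ?_, ?_⟩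
  · simp [excess, Segment.double, hu, hx₁, hy₁, hv, hx₂, hy₂, ht]
  · simp only [Segment.double, List.nodup_cons, List.mem_cons, List.not_mem_nil, or_false, not_or]
    grind
  · rw [Finset.disjoint_left]
    intro z hz
    simp only [Segment.double, List.mem_toFinset, List.mem_cons, List.not_mem_nil, or_false] at hz
    grind
  · intro z hz
    simp only [Segment.double, List.mem_cons, List.not_mem_nil, or_false, Finset.mem_singleton]
    grind

theorem sum_excess (B : Finset α) (S : List (Segment H)) :
    (S.map fun s => excess B s.l).sum = ((S.flatMap Segment.l).countP (· ∈ B) : ℤ)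
      - 3 * ((S.flatMap Segment.l).countP (· ∉ B) : ℤ) - 3 * S.length := by
  induction S with
  | nil => simp
  | cons s S ih =>
    rw [List.map_cons, List.sum_cons, ih, List.flatMap_cons, List.countP_append,
      List.countP_append, excess, List.length_cons]
    push_cast
    ring

theorem sum_excess_eq_mul {B : Finset α} {S : List (Segment H)} {e : ℤ}
    (h : ∀ s ∈ S, excess B s.l = e) : (S.map fun s => excess B s.l).sum = S.length * e := by
  induction S with
  | nil => simp
  | cons s S ih =>
    rw [List.map_cons, List.sum_cons, ih fun t ht => h t (List.mem_cons_of_mem _ ht),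
      h s List.mem_cons_self, List.length_cons]
    push_cast
    ring

theorem card_sdiff_add_countP {L : List α} (hL : L.Nodup) (B : Finset α) (p : α → Bool)
    (hp : ∀ x, p x ↔ x ∈ B) : (B \ L.toFinset).card + L.countP p = B.card := by
  have h : L.countP p = (B ∩ L.toFinset).card := by
    rw [List.countP_eq_length_filter, ← List.toFinset_card_of_nodup (hL.filter _)]
    congr 1
    ext x
    simp [hp, and_comm]
  rw [h, Finset.card_sdiff_add_card_inter]

theorem exists_disjoint_double_segments (h3 : ∀ e ∈ H, e.card = 3) {A B : Finset α} {c K : ℝ}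
    (hp : HasPartners H A B c K) (E U : Finset α) (hEB : ∀ v ∈ E, v ∉ B)
    (hr : ∀ v ∈ E, Rich H B v K) (hEU : ∀ v ∈ E, v ∉ U)
    (hK : (U.card : ℝ) + 7 * E.card + 6 ≤ K) :
    ∃ S : List (Segment H), S.length = E.card ∧ (S.flatMap Segment.l).Nodup ∧
      (∀ v ∈ S.flatMap Segment.l, v ∉ U) ∧ (S.flatMap Segment.l).length ≤ 7 * E.card ∧
      (∀ s ∈ S, s.Good A c) ∧ (S.map fun s => excess B s.l).sum = 0 ∧
      ∀ v, v ∉ B → (v ∈ S.flatMap Segment.l ↔ v ∈ E) := by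
  obtain ⟨S, h1, h2, h3, h4, h5⟩ := exists_disjoint_segments (H := H) (fun v : α => {v})
    (fun _ s => s.Good A c ∧ excess B s.l = 0) B U (U.card + 7 * E.card) E
    (by simpa using hEB) (by simp) (by simpa using hEU)
    (by
      intro v hv U' hU' hvU'
      refine exists_double_segment h3 hp (hEB v hv) (hr v hv) U' ?_ hvU'
      have : (U'.card : ℝ) ≤ U.card + 7 * E.card := by exact_mod_cast hU'
      linarith) le_rfl
  refine ⟨S, h1, h2, h3, ?_, fun s hs => ?_, ?_, by simpa using h5⟩
  · rw [← h1]
    exact length_flatMap_le fun s hs => (h4 s hs).1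
  · obtain ⟨-, i, -, h⟩ := h4 s hs
    exact h.1
  · rw [sum_excess_eq_mul (e := 0), mul_zero]
    intro s hs
    obtain ⟨-, i, -, h⟩ := h4 s hs
    exact h.2

end Assembly

section MainAssembly

variable {α : Type*} [DecidableEq α] {H : Finset (Finset α)}

theorem card_mul_le_of_few_links (S : List (Segment H)) (d : Segment H) (E : Finset α) (c q : ℝ)
    (hgood : ∀ s ∈ S, s.Good E c)
    (hE : ∀ a ∈ E, (((Finset.range (S.length - 1)).filter fun j =>
      Links H (S.getD j d) (S.getD (j + 1) d) a).card : ℝ) ≤ q) :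
    (E.card : ℝ) * (((S.length - 1 : ℕ) : ℝ) - q) ≤ ((S.length - 1 : ℕ) : ℝ) * (2 * c) := by
  set J := Finset.range (S.length - 1)
  have hJ : (J.card : ℝ) = ((S.length - 1 : ℕ) : ℝ) := by simp [J]
  have hmem : ∀ j < S.length, S.getD j d ∈ S := fun j hj => by
    rw [List.getD_eq_getElem _ _ hj]; exact List.getElem_mem _
  have key := Finset.sum_card_bipartiteAbove_eq_sum_card_bipartiteBelow (s := E) (t := J)
    (fun a j => ¬ Links H (S.getD j d) (S.getD (j + 1) d) a)
  simp only [Finset.bipartiteAbove, Finset.bipartiteBelow] at key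
  have h1 : (E.card : ℝ) * (J.card - q) ≤
      ∑ a ∈ E, ((J.filter fun j => ¬ Links H (S.getD j d) (S.getD (j + 1) d) a).card : ℝ) := by
    rw [← nsmul_eq_mul]
    refine Finset.card_nsmul_le_sum _ _ _ fun a ha => ?_
    have h2 := Finset.card_filter_add_card_filter_not (s := J)
      (fun j => Links H (S.getD j d) (S.getD (j + 1) d) a)
    have h3 : ((J.filter fun j => Links H (S.getD j d) (S.getD (j + 1) d) a).card : ℝ) +
      (J.filter fun j => ¬ Links H (S.getD j d) (S.getD (j + 1) d) a).card = J.card := by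
      exact_mod_cast h2
    linarith [hE a ha]
  have h2 : ∑ j ∈ J,
      ((E.filter fun a => ¬ Links H (S.getD j d) (S.getD (j + 1) d) a).card : ℝ) ≤
      J.card * (2 * c) := by
    rw [← nsmul_eq_mul]
    refine Finset.sum_le_card_nsmul _ _ _ fun j hj => ?_
    have hj' := Finset.mem_range.1 hj
    exact card_filter_not_links_le (hgood _ (hmem _ (by omega))) (hgood _ (hmem _ (by omega)))
  rw [hJ] at h1 h2
  refine h1.trans (le_trans (le_of_eq ?_) h2)
  exact_mod_cast key

theorem Segment.Good.mono {s : Segment H} {A A' : Finset α} {c c' : ℝ} (h : s.Good A c)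
    (hA : A' ⊆ A) (hc : c ≤ c') : s.Good A' c' := by
  have h1 : ∀ x y, (pairMiss H A' x y : ℝ) ≤ pairMiss H A x y := fun x y => by
    exact_mod_cast pairMiss_mono hA x y
  exact ⟨(h1 _ _).trans (h.1.trans hc), (h1 _ _).trans (h.2.trans hc)⟩

theorem exists_good_cherries (R A : Finset α) (r : ℕ) (hR : R.card = 3 * r) (c p : ℝ)
    (hp : 2 * p < r)
    (hg : ∀ x ∈ R, ((R.filter fun y => ¬ (x ≠ y ∧ (pairMiss H A x y : ℝ) ≤ c)).card : ℝ) ≤ p) :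
    ∃ S : List (Segment H), S.length = r ∧ (S.flatMap Segment.l).Nodup ∧
      (S.flatMap Segment.l).toFinset = R ∧ ∀ s ∈ S, s.Good A c := by
  classical
  obtain ⟨S, h1, h2, h3, h4⟩ := exists_cherries (H := H) R r hR
    (fun x y => x ≠ y ∧ (pairMiss H A x y : ℝ) ≤ c) p hp
    (fun x hx => by convert hg x hx) (fun x y h => ⟨h.1.symm, by rw [pairMiss_comm]; exact h.2⟩)
  refine ⟨S, h1, h2, h3, fun s hs => ?_⟩
  obtain ⟨z, w, y, rfl, hz, hy⟩ := h4 s hs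
  exact ⟨hz.2, hy.2⟩

theorem hasPartners_of_card_le {A B : Finset α} {c p K : ℝ} (hK : K + p < B.card)
    (hG : ∀ x ∈ B, ((B.filter fun y => ¬ (x ≠ y ∧ (pairMiss H A x y : ℝ) ≤ c)).card : ℝ) ≤ p) :
    HasPartners H A B c K := by
  intro x hx U hU
  by_contra! hcon
  have : B ⊆ U ∪ B.filter fun y => ¬ (x ≠ y ∧ (pairMiss H A x y : ℝ) ≤ c) := by
    intro y hy
    by_cases hyU : y ∈ U
    · exact Finset.mem_union_left _ hyU
    · refine Finset.mem_union_right _ (Finset.mem_filter.2 ⟨hy, fun h => ?_⟩)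
      exact absurd h.2 (not_le.2 (hcon y hy hyU))
  have h1 := (Finset.card_le_card this).trans (Finset.card_union_le _ _)
  have h2 : (B.card : ℝ) ≤ U.card +
    (B.filter fun y => ¬ (x ≠ y ∧ (pairMiss H A x y : ℝ) ≤ c)).card := by exact_mod_cast h1
  linarith [hG x hx]

theorem exists_loose_cycle_of_special [Fintype α] (h3 : ∀ e ∈ H, e.card = 3)
    (B N V₀ : Finset α) (n : ℕ) (hn0 : 10 ^ 9 ≤ n)
    (hB : 74 / 100 * (n : ℝ) ≤ B.card)
    (hG : ∀ x ∈ B, ((B.filter fun y =>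
      ¬ (x ≠ y ∧ (pairMiss H Bᶜ x y : ℝ) ≤ n / 40)).card : ℝ) ≤ n / 50)
    (hNB : N ⊆ B) (hN : ((B \ N).card : ℝ) ≤ n / 100)
    (hVG : ∀ x ∈ N, ((B.filter fun y =>
      ¬ (x ≠ y ∧ (pairMiss H Bᶜ x y : ℝ) ≤ n / 1000)).card : ℝ) ≤ n / 500)
    (hrich : ∀ v ∉ B, Rich H B v (n / 10 ^ 5))
    (hV₀ : (V₀.card : ℝ) ≤ n / 10 ^ 7) (htyp : ∀ v ∉ B, v ∉ V₀ → Rich H B v (45 / 100 * n))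
    (S₀ : List (Segment H)) (hS₀ : ∀ s ∈ S₀, s.Good Bᶜ (n / 40))
    (hS₀d : (S₀.flatMap Segment.l).Nodup)
    (hS₀l : ((S₀.flatMap Segment.l).length : ℝ) ≤ n / 10 ^ 6)
    (hS₀e : (S₀.map fun s => excess B s.l).sum = (B.card : ℤ) - 3 * (Bᶜ.card : ℤ)) :
    ∃ a l, (a :: l).Nodup ∧ (a :: l).toFinset = Finset.univ ∧ IsLoosePath H (a :: l ++ [a]) := by
  have hnR : (10 : ℝ) ^ 9 ≤ n := by exact_mod_cast hn0
  have hpart : HasPartners H Bᶜ B (n / 40) (7 / 10 * n) :=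
    hasPartners_of_card_le (by linarith) hG
  set U₀ := (S₀.flatMap Segment.l).toFinset with hU₀
  have hU₀c : (U₀.card : ℝ) ≤ n / 10 ^ 6 := by
    refine le_trans ?_ hS₀l
    exact_mod_cast List.toFinset_card_le _
  -- absorb the atypical vertices
  set V₁ := (Bᶜ ∩ V₀) \ U₀ with hV₁
  have hV₁c : (V₁.card : ℝ) ≤ n / 10 ^ 7 := by
    refine le_trans ?_ hV₀
    exact_mod_cast Finset.card_le_card (Finset.sdiff_subset.trans Finset.inter_subset_right)
  have hV₁m : ∀ v ∈ V₁, v ∉ B ∧ v ∉ U₀ := fun v hv => by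
    simp only [hV₁, Finset.mem_sdiff, Finset.mem_inter, Finset.mem_compl] at hv
    exact ⟨hv.1.1, hv.2⟩
  obtain ⟨S₁, -, hS₁d, hS₁U, hS₁l, hS₁g, hS₁e, hS₁m⟩ := exists_disjoint_double_segments h3
    (hpart.mono (by linarith : (n : ℝ) / 10 ^ 5 ≤ 7 / 10 * n)) V₁ U₀ (fun v hv => (hV₁m v hv).1)
    (fun v hv => hrich v (hV₁m v hv).1) (fun v hv => (hV₁m v hv).2) (by linarith)
  set U₁ := (S₁.flatMap Segment.l).toFinset with hU₁
  have hU₁c : (U₁.card : ℝ) ≤ n / 10 ^ 6 := by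
    have h1 : (U₁.card : ℝ) ≤ 7 * V₁.card := by
      exact_mod_cast (List.toFinset_card_le _).trans hS₁l
    linarith
  -- choose the reserved cherries
  set f := n / 10 with hf
  have hf1 : (f : ℝ) ≤ n / 10 := by
    rw [le_div_iff₀ (by norm_num)]; exact_mod_cast (by omega : f * 10 ≤ n)
  have hf2 : (n : ℝ) / 10 - 1 ≤ f := by
    have : (n : ℝ) ≤ 10 * f + 10 := by exact_mod_cast (by omega : n ≤ 10 * f + 10)
    linarith
  have hNc : 3 * f ≤ (N \ (U₀ ∪ U₁)).card := by
    have h1 := Finset.card_sdiff_add_card_inter B N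
    rw [Finset.inter_eq_right.2 hNB] at h1
    have h2 := Finset.le_card_sdiff (U₀ ∪ U₁) N
    have h3 := Finset.card_union_le U₀ U₁
    have h4 : B.card ≤ (B \ N).card + (U₀.card + U₁.card + (N \ (U₀ ∪ U₁)).card) := by omega
    have h5 : (B.card : ℝ) ≤ (B \ N).card + (U₀.card + U₁.card + (N \ (U₀ ∪ U₁)).card) := by
      exact_mod_cast h4
    have h6 : 3 * (f : ℝ) ≤ (N \ (U₀ ∪ U₁)).card := by linarith
    exact_mod_cast h6
  obtain ⟨R₂, hR₂, hR₂c⟩ := Finset.exists_subset_card_eq hNc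
  have hR₂m : ∀ v ∈ R₂, v ∈ N ∧ v ∈ B ∧ v ∉ U₀ ∧ v ∉ U₁ := fun v hv => by
    have := hR₂ hv
    simp only [Finset.mem_sdiff, Finset.mem_union, not_or] at this
    exact ⟨this.1, hNB this.1, this.2⟩
  obtain ⟨S₂, hS₂l, hS₂d, hS₂c, hS₂g⟩ := exists_good_cherries (H := H) R₂ Bᶜ f hR₂c (n / 1000)
    (n / 500) (by linarith) (fun x hx => by
      refine le_trans ?_ (hVG x (hR₂m x hx).1)
      exact_mod_cast Finset.card_le_card
        (Finset.filter_subset_filter _ fun v hv => (hR₂m v hv).2.1))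
  have hS₂B : ∀ v ∈ S₂.flatMap Segment.l, v ∈ R₂ := fun v hv => by
    rw [← hS₂c]; exact List.mem_toFinset.2 hv
  obtain ⟨d, hd⟩ : ∃ d, d ∈ S₂ := by
    refine List.exists_mem_of_length_pos ?_
    rw [hS₂l]; omega
  -- absorb the vertices that link few of the reserved cherries
  set E := ((Bᶜ \ U₀) \ U₁).filter fun a => (((Finset.range (S₂.length - 1)).filter fun j =>
      Links H (S₂.getD j d) (S₂.getD (j + 1) d) a).card : ℝ) ≤ n / 20 with hE
  have hEm : ∀ v ∈ E, v ∉ B ∧ v ∉ U₀ ∧ v ∉ U₁ := fun v hv => by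
    have := (Finset.mem_filter.1 hv).1
    simp only [Finset.mem_sdiff, Finset.mem_compl] at this
    tauto
  have hEc : (E.card : ℝ) ≤ n / 100 := by
    have h1 := card_mul_le_of_few_links S₂ d E (n / 1000) (n / 20)
      (fun s hs => (hS₂g s hs).mono (fun v hv => Finset.mem_compl.2 (hEm v hv).1) le_rfl)
      (fun a ha => (Finset.mem_filter.1 ha).2)
    have h2 : ((S₂.length - 1 : ℕ) : ℝ) = f - 1 := by
      rw [hS₂l, Nat.cast_sub (by omega)]; simp
    rw [h2] at h1
    have h3 : (E.card : ℝ) * (n * (4 / 100)) ≤ n / 10 * (2 * (n / 1000)) :=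
      calc (E.card : ℝ) * (n * (4 / 100)) ≤ E.card * (f - 1 - n / 20) := by gcongr; linarith
        _ ≤ (f - 1) * (2 * (n / 1000)) := h1
        _ ≤ _ := by gcongr; linarith
    have h4 : (E.card : ℝ) * (n * (4 / 100)) ≤ (n / 100) * (n * (4 / 100)) := by
      nlinarith [sq_nonneg (n : ℝ)]
    exact le_of_mul_le_mul_right h4 (by linarith)
  set U₂ := (U₀ ∪ U₁) ∪ R₂ with hU₂
  have hU₂c : (U₂.card : ℝ) ≤ 31 / 100 * n := by
    have h1 : U₂.card ≤ U₀.card + U₁.card + R₂.card :=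
      (Finset.card_union_le _ _).trans (by gcongr; exact Finset.card_union_le _ _)
    have h2 : (U₂.card : ℝ) ≤ U₀.card + U₁.card + R₂.card := by exact_mod_cast h1
    have h3 : (R₂.card : ℝ) = 3 * f := by rw [hR₂c]; simp
    linarith
  have hEV : ∀ v ∈ E, v ∉ V₀ := by
    intro v hv hv0
    obtain ⟨h1, h2, h3⟩ := hEm v hv
    refine h3 (List.mem_toFinset.2 ((hS₁m v h1).2 ?_))
    simp [hV₁, h1, h2, hv0]
  obtain ⟨S₃, -, hS₃d, hS₃U, hS₃l, hS₃g, hS₃e, hS₃m⟩ := exists_disjoint_double_segments h3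
    (hpart.mono (by linarith : 45 / 100 * (n : ℝ) ≤ 7 / 10 * n)) E U₂ (fun v hv => (hEm v hv).1)
    (fun v hv => htyp v (hEm v hv).1 (hEV v hv))
    (fun v hv => by
      simp only [hU₂, Finset.mem_union, not_or]
      exact ⟨⟨(hEm v hv).2.1, (hEm v hv).2.2⟩, fun h => (hEm v hv).1 (hR₂m v h).2.1⟩)
    (by linarith)
  -- the segments so far
  set S₄ := S₂ ++ (S₀ ++ S₁ ++ S₃) with hS₄
  have hflat : S₄.flatMap Segment.l = S₂.flatMap Segment.l ++
      (S₀.flatMap Segment.l ++ S₁.flatMap Segment.l ++ S₃.flatMap Segment.l) := by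
    simp [hS₄, List.flatMap_append]
  have hS₄d : (S₄.flatMap Segment.l).Nodup := by
    rw [hflat, List.nodup_append', List.nodup_append', List.nodup_append']
    refine ⟨hS₂d, ⟨⟨hS₀d, hS₁d, ?_⟩, hS₃d, ?_⟩, ?_⟩
    · intro v h1 h2
      exact hS₁U v h2 (List.mem_toFinset.2 h1)
    · intro v h1 h2
      refine hS₃U v h2 (Finset.mem_union_left _ ?_)
      rw [Finset.mem_union, hU₀, hU₁, List.mem_toFinset, List.mem_toFinset]
      exact List.mem_append.1 h1
    · intro v h1 h2
      have hv := hS₂B v h1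
      rw [List.mem_append, List.mem_append] at h2
      rcases h2 with (h2 | h2) | h2
      · exact (hR₂m v hv).2.2.1 (List.mem_toFinset.2 h2)
      · exact (hR₂m v hv).2.2.2 (List.mem_toFinset.2 h2)
      · exact hS₃U v h2 (Finset.mem_union_right _ hv)
  set U₄ := (S₄.flatMap Segment.l).toFinset with hU₄
  have hU₄c : (U₄.card : ℝ) ≤ 4 / 10 * n := by
    have h1 : U₄.card ≤ R₂.card + (U₀.card + U₁.card + 7 * E.card) := by
      rw [hU₄, hflat, List.toFinset_append, List.toFinset_append, List.toFinset_append, hS₂c]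
      refine (Finset.card_union_le _ _).trans ?_
      gcongr
      refine (Finset.card_union_le _ _).trans ?_
      gcongr
      · exact Finset.card_union_le _ _
      · exact (List.toFinset_card_le _).trans hS₃l
    have h2 : (U₄.card : ℝ) ≤ R₂.card + (U₀.card + U₁.card + 7 * E.card) := by exact_mod_cast h1
    have h3 : (R₂.card : ℝ) = 3 * f := by rw [hR₂c]; simp
    linarith
  -- the remaining vertices
  have hcount : ((B \ U₄).card : ℤ) = 3 * (((Bᶜ \ U₄).card : ℤ) - S₄.length) := by
    have h1 := card_sdiff_add_countP hS₄d B (· ∈ B) (by simp)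
    have h2 := card_sdiff_add_countP hS₄d Bᶜ (· ∉ B) (by simp)
    have h3 := sum_excess B S₄
    have h4 : (S₄.map fun s => excess B s.l).sum = (B.card : ℤ) - 3 * (Bᶜ.card : ℤ) := by
      have h5 : (S₂.map fun s => excess B s.l).sum = 0 := by
        have h6 := sum_excess B S₂
        have h7 := card_sdiff_add_countP hS₂d B (· ∈ B) (by simp)
        have h8 : (S₂.flatMap Segment.l).countP (· ∈ B) = 3 * f := by
          rw [List.countP_eq_length.2, ← List.toFinset_card_of_nodup hS₂d, hS₂c, hR₂c]
          intro v hv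
          simpa using (hR₂m v (hS₂B v hv)).2.1
        have h9 : (S₂.flatMap Segment.l).countP (· ∉ B) = 0 := by
          rw [List.countP_eq_zero]
          intro v hv
          simpa using (hR₂m v (hS₂B v hv)).2.1
        rw [h6, h8, h9, hS₂l]
        push_cast
        ring
      simp only [hS₄, List.map_append, List.sum_append, h5, hS₁e, hS₃e, hS₀e]
      ring
    rw [h4] at h3
    rw [← hU₄] at h1 h2
    zify at h1 h2
    linarith
  obtain ⟨r, hr⟩ : ∃ r, (Bᶜ \ U₄).card = S₄.length + r := ⟨(Bᶜ \ U₄).card - S₄.length, by omega⟩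
  have hR : (B \ U₄).card = 3 * r := by omega
  have hr' : 2 * ((n : ℝ) / 50) < r := by
    have h1 := Finset.le_card_sdiff U₄ B
    have h2 : B.card ≤ 3 * r + U₄.card := by omega
    have h3 : (B.card : ℝ) ≤ 3 * r + U₄.card := by exact_mod_cast h2
    linarith
  obtain ⟨S₅, hS₅l, hS₅d, hS₅c, hS₅g⟩ := exists_good_cherries (H := H) (B \ U₄) Bᶜ r hR (n / 40)
    (n / 50) hr' (fun x hx => by
      refine le_trans ?_ (hG x (Finset.mem_sdiff.1 hx).1)
      exact_mod_cast Finset.card_le_card (Finset.filter_subset_filter _ Finset.sdiff_subset))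
  have hS₅m : ∀ v ∈ S₅.flatMap Segment.l, v ∈ B \ U₄ := fun v hv => by
    rw [← hS₅c]; exact List.mem_toFinset.2 hv
  obtain ⟨a, l, h1, h2, h4⟩ := exists_loose_cycle_of_segments (S₄ ++ S₅)
    (by simp only [hS₄, List.length_append, hS₂l]; omega) d (Bᶜ \ U₄)
    (by rw [List.length_append, hS₅l, hr])
    (by
      rw [List.flatMap_append, List.nodup_append']
      refine ⟨hS₄d, hS₅d, fun v hv hv' => ?_⟩
      exact (Finset.mem_sdiff.1 (hS₅m v hv')).2 (List.mem_toFinset.2 hv))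
    (by
      intro v hv hvA
      rw [List.flatMap_append, List.mem_append] at hv
      rw [Finset.mem_sdiff, Finset.mem_compl] at hvA
      rcases hv with hv | hv
      · exact hvA.2 (List.mem_toFinset.2 hv)
      · exact hvA.1 (Finset.mem_sdiff.1 (hS₅m v hv)).1)
    (n / 40)
    (by
      intro s hs
      refine Segment.Good.mono (A := Bᶜ) (c := n / 40) ?_ Finset.sdiff_subset le_rfl
      simp only [hS₄, List.mem_append] at hs
      rcases hs with (hs | (hs | hs) | hs) | hs
      · exact (hS₂g s hs).mono subset_rfl (by linarith)
      · exact hS₀ s hs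
      · exact hS₁g s hs
      · exact hS₃g s hs
      · exact hS₅g s hs)
    (by
      intro a ha
      rw [Finset.mem_sdiff, Finset.mem_compl] at ha
      have haE : a ∉ E := fun h => ha.2 (by
        rw [hU₄, List.mem_toFinset, hflat]
        simp only [List.mem_append]
        exact Or.inr (Or.inr ((hS₃m a ha.1).2 h)))
      have ha' : (n : ℝ) / 20 < (((Finset.range (S₂.length - 1)).filter fun j =>
          Links H (S₂.getD j d) (S₂.getD (j + 1) d) a).card : ℝ) := by
        by_contra hcon
        refine haE (Finset.mem_filter.2 ⟨?_, not_lt.1 hcon⟩)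
        have : a ∉ U₀ ∧ a ∉ U₁ := by
          have := ha.2
          rw [hU₄, List.mem_toFinset, hflat] at this
          simp only [List.mem_append, not_or] at this
          simp only [hU₀, hU₁, List.mem_toFinset]
          exact ⟨this.2.1.1, this.2.1.2⟩
        simp only [Finset.mem_sdiff, Finset.mem_compl]
        exact ⟨⟨ha.1, this.1⟩, this.2⟩
      refine lt_of_eq_of_lt (by ring) (ha'.trans_le ?_)
      have hsub : ((Finset.range (S₂.length - 1)).filter fun j =>
          Links H (S₂.getD j d) (S₂.getD (j + 1) d) a) ⊆
          ((Finset.range ((S₄ ++ S₅).length - 1)).filter fun j =>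
          Links H ((S₄ ++ S₅).getD j d) ((S₄ ++ S₅).getD (j + 1) d) a) := by
        intro j hj
        rw [Finset.mem_filter, Finset.mem_range] at hj ⊢
        have hlen : S₂.length ≤ (S₄ ++ S₅).length := by
          simp only [hS₄, List.length_append]; omega
        refine ⟨by omega, ?_⟩
        rw [hS₄, List.append_assoc, List.getD_append _ _ _ _ (by omega),
          List.getD_append _ _ _ _ (by omega)]
        exact hj.2
      exact_mod_cast Finset.card_le_card hsub)
  refine ⟨a, l, h1, ?_, h4⟩
  rw [h2, Finset.eq_univ_iff_forall]
  intro v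
  rw [List.flatMap_append, List.toFinset_append, hS₅c]
  simp only [Finset.mem_union, Finset.mem_sdiff, Finset.mem_compl]
  tauto

end MainAssembly

section Special

variable {α : Type*} [DecidableEq α] {H : Finset (Finset α)}

/-- The ordered pairs from `S` that form an edge with `v`. -/
def linkPairs (H : Finset (Finset α)) (v : α) (S : Finset α) : Finset (α × α) :=
  (S ×ˢ S).filter fun p => ({v, p.1, p.2} : Finset α) ∈ H

theorem mem_linkPairs {v : α} {S : Finset α} {p : α × α} :
    p ∈ linkPairs H v S ↔ (p.1 ∈ S ∧ p.2 ∈ S) ∧ ({v, p.1, p.2} : Finset α) ∈ H := by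
  simp [linkPairs]

theorem sum_card_linkPairs_le_of_cover {B U : Finset α}
    (h : ∀ v ∈ B, ∀ x ∈ B, ∀ y ∈ B, ({v, x, y} : Finset α) ∈ H → v ∈ U ∨ x ∈ U ∨ y ∈ U) :
    ∑ v ∈ B, (linkPairs H v B).card ≤ 3 * ∑ v ∈ B ∩ U, (linkPairs H v B).card := by
  set T := (B ∩ U).sigma fun v => linkPairs H v B with hT
  have hTc : T.card = ∑ v ∈ B ∩ U, (linkPairs H v B).card := Finset.card_sigma _ _
  rw [← hTc, ← Finset.card_sigma]
  have hsub : (B.sigma fun v => linkPairs H v B) ⊆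
      T ∪ (T.image fun q => ⟨q.2.1, (q.1, q.2.2)⟩) ∪ (T.image fun q => ⟨q.2.2, (q.2.1, q.1)⟩) := by
    rintro ⟨v, x, y⟩ hq
    simp only [Finset.mem_sigma, mem_linkPairs] at hq
    obtain ⟨hv, ⟨hx, hy⟩, he⟩ := hq
    simp only [Finset.mem_union, Finset.mem_image, hT, Finset.mem_sigma, mem_linkPairs,
      Finset.mem_inter]
    rcases h v hv x hx y hy he with hU | hU | hU
    · exact Or.inl (Or.inl ⟨⟨hv, hU⟩, ⟨hx, hy⟩, he⟩)
    · refine Or.inl (Or.inr ⟨⟨x, v, y⟩, ⟨⟨hx, hU⟩, ⟨hv, hy⟩, ?_⟩, rfl⟩)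
      convert he using 1; grind
    · refine Or.inr ⟨⟨y, x, v⟩, ⟨⟨hy, hU⟩, ⟨hx, hv⟩, ?_⟩, rfl⟩
      convert he using 1; grind
  refine (Finset.card_le_card hsub).trans ?_
  refine (Finset.card_union_le _ _).trans ?_
  have h1 := Finset.card_union_le T
    (T.image fun q => (⟨q.2.1, (q.1, q.2.2)⟩ : Σ _ : α, α × α))
  have h2 := Finset.card_image_le (s := T)
    (f := fun q => (⟨q.2.1, (q.1, q.2.2)⟩ : Σ _ : α, α × α))
  have h3 := Finset.card_image_le (s := T)
    (f := fun q => (⟨q.2.2, (q.2.1, q.1)⟩ : Σ _ : α, α × α))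
  omega

theorem exists_edge_segment (h3 : ∀ e ∈ H, e.card = 3) {A B U : Finset α} {c K : ℝ}
    (hp : HasPartners H A B c K) {v x y : α} (hx : x ∈ B) (hy : y ∈ B)
    (h : ({v, x, y} : Finset α) ∈ H) (hU : (U.card : ℝ) + 6 ≤ K)
    (hvU : v ∉ U) (hxU : x ∉ U) (hyU : y ∉ U) :
    ∃ s : Segment H, s.Good A c ∧ excess B s.l = (if v ∈ B then 2 else -2) ∧ s.l.Nodup ∧
      s.l.length ≤ 7 ∧ Disjoint s.l.toFinset U ∧ ∀ z, z ∉ B → (z ∈ s.l ↔ z = v) := by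
  have hcard : ∀ (T : Finset α), T.card ≤ 6 → ((U ∪ T).card : ℝ) ≤ K := by
    intro T hT
    have h1 : ((U ∪ T).card : ℝ) ≤ U.card + T.card := by exact_mod_cast Finset.card_union_le U T
    have h2 : (T.card : ℝ) ≤ 6 := by exact_mod_cast hT
    linarith
  obtain ⟨u, hu, huU, hu'⟩ := hp x hx (U ∪ {v, x, y})
    (hcard _ (Finset.card_le_three.trans (by norm_num)))
  obtain ⟨t, ht, htU, ht'⟩ := hp y hy (U ∪ {u, v, x, y})
    (hcard _ (Finset.card_le_four.trans (by norm_num)))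
  obtain ⟨a1, a2, a3⟩ := ne_of_edge_mem h3 h
  simp only [Finset.mem_union, Finset.mem_insert, Finset.mem_singleton, not_or] at huU htU
  refine ⟨Segment.edge (u := u) (x := x) (v := v) (y := y) (u' := t)
    (by convert h using 1; grind), ⟨hu', ht'⟩, ?_, ?_, by simp [Segment.edge], ?_, ?_⟩
  · by_cases hv : v ∈ B <;> simp [excess, Segment.edge, hu, hx, hy, hv, ht]
  · simp only [Segment.edge, List.nodup_cons, List.mem_cons, List.not_mem_nil, or_false, not_or]
    grind
  · rw [Finset.disjoint_left]
    intro z hz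
    simp only [Segment.edge, List.mem_toFinset, List.mem_cons, List.not_mem_nil, or_false] at hz
    grind
  · intro z hz
    simp only [Segment.edge, List.mem_cons, List.not_mem_nil, or_false]
    grind

/-- Two distinct edges through each vertex force two distinct edges that share at most one
vertex. -/
theorem exists_edges_inter_card_le_one {F : Finset (Finset α)} (hF : ∀ e ∈ F, e.card = 3)
    {B : Finset α} (hB : 5 ≤ B.card)
    (h : ∀ v ∈ B, ∃ e₁ ∈ F, ∃ e₂ ∈ F, e₁ ≠ e₂ ∧ v ∈ e₁ ∧ v ∈ e₂) :
    ∃ e₁ ∈ F, ∃ e₂ ∈ F, (e₁ ∩ e₂).card ≤ 1 := by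
  by_contra! hcon
  obtain ⟨v, hv⟩ : B.Nonempty := Finset.card_pos.1 (by omega)
  obtain ⟨e₁, he₁, e₂, he₂, hne, -, -⟩ := h v hv
  have hu : (e₁ ∪ e₂).card ≤ 4 := by
    have h1 := Finset.card_union_add_card_inter e₁ e₂
    have h2 := hcon e₁ he₁ e₂ he₂
    rw [hF _ he₁, hF _ he₂] at h1
    omega
  obtain ⟨w, hw, hwn⟩ := Finset.exists_mem_notMem_of_card_lt_card
    (show (e₁ ∪ e₂).card < B.card by omega)
  obtain ⟨f₁, hf₁, f₂, hf₂, hfne, hw₁, hw₂⟩ := h w hw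
  rw [Finset.mem_union, not_or] at hwn
  have hint : (e₁ ∩ e₂).card ≤ 2 := by
    by_contra hc
    have h1 : e₁ ∩ e₂ = e₁ := Finset.eq_of_subset_of_card_le Finset.inter_subset_left
      (by rw [hF _ he₁]; omega)
    have h2 : e₁ ∩ e₂ = e₂ := Finset.eq_of_subset_of_card_le Finset.inter_subset_right
      (by rw [hF _ he₂]; omega)
    exact hne (h1.symm.trans h2)
  have key : ∀ f ∈ F, w ∈ f → f = insert w (e₁ ∩ e₂) := by
    intro f hf hwf
    have hfc : (f.erase w).card = 2 := by rw [Finset.card_erase_of_mem hwf, hF _ hf]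
    have hsub : ∀ e ∈ F, w ∉ e → f.erase w ⊆ e := by
      intro e he hwe
      have h1 : e ∩ f ⊆ f.erase w := fun z hz => by
        rw [Finset.mem_inter] at hz
        exact Finset.mem_erase.2 ⟨fun h => hwe (h ▸ hz.1), hz.2⟩
      have h2 : e ∩ f = f.erase w := Finset.eq_of_subset_of_card_le h1 (by
        rw [hfc]; exact hcon e he f hf)
      rw [← h2]; exact Finset.inter_subset_left
    have h4 : f.erase w = e₁ ∩ e₂ := Finset.eq_of_subset_of_card_le
      (Finset.subset_inter (hsub e₁ he₁ hwn.1) (hsub e₂ he₂ hwn.2)) (by omega)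
    rw [← h4, Finset.insert_erase hwf]
  exact hfne ((key f₁ hf₁ hw₁).trans (key f₂ hf₂ hw₂).symm)

theorem exists_two_edges_of_linkPairs (h3 : ∀ e ∈ H, e.card = 3) {v : α} {B : Finset α}
    (hv : v ∈ B) (h : 4 ≤ (linkPairs H v B).card) :
    ∃ e₁ ∈ H.filter (· ⊆ B), ∃ e₂ ∈ H.filter (· ⊆ B), e₁ ≠ e₂ ∧ v ∈ e₁ ∧ v ∈ e₂ := by
  have hmem : ∀ p ∈ linkPairs H v B, ({v, p.1, p.2} : Finset α) ∈ H.filter (· ⊆ B) := by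
    intro p hp
    rw [mem_linkPairs] at hp
    refine Finset.mem_filter.2 ⟨hp.2, ?_⟩
    simp [Finset.insert_subset_iff, hv, hp.1]
  obtain ⟨p, hp⟩ : (linkPairs H v B).Nonempty := Finset.card_pos.1 (by omega)
  by_contra! hcon
  have hsub : linkPairs H v B ⊆ {p, (p.2, p.1)} := by
    intro q hq
    have h1 : ({v, p.1, p.2} : Finset α) = {v, q.1, q.2} := by
      by_contra hne
      exact hcon _ (hmem p hp) _ (hmem q hq) hne (by simp) (by simp)
    obtain ⟨a1, a2, a3⟩ := ne_of_edge_mem h3 (mem_linkPairs.1 hp).2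
    obtain ⟨b1, b2, b3⟩ := ne_of_edge_mem h3 (mem_linkPairs.1 hq).2
    have h4 : q.1 ∈ ({v, p.1, p.2} : Finset α) := by rw [h1]; simp
    have h5 : q.2 ∈ ({v, p.1, p.2} : Finset α) := by rw [h1]; simp
    obtain ⟨p1, p2⟩ := p
    obtain ⟨q1, q2⟩ := q
    simp only [Finset.mem_insert, Finset.mem_singleton, Prod.mk.injEq] at *
    grind
  have := (Finset.card_le_card hsub).trans Finset.card_le_two
  omega

/-- Two distinct edges inside `B` that share at most one vertex can be covered by segments. -/
theorem exists_segments_of_two_edges (h3 : ∀ e ∈ H, e.card = 3) {A B : Finset α} {c K : ℝ}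
    (hp : HasPartners H A B c K) (hK : 20 ≤ K) {e₁ e₂ : Finset α} (he₁ : e₁ ∈ H) (he₂ : e₂ ∈ H)
    (h₁ : e₁ ⊆ B) (h₂ : e₂ ⊆ B) (hi : (e₁ ∩ e₂).card ≤ 1) :
    ∃ S : List (Segment H), (∀ s ∈ S, s.Good A c) ∧ (S.flatMap Segment.l).Nodup ∧
      (S.flatMap Segment.l).length ≤ 14 ∧ (S.map fun s => excess B s.l).sum = 4 := by
  rcases Nat.le_one_iff_eq_zero_or_eq_one.1 hi with hi | hi
  · obtain ⟨x, y, z, -, -, -, rfl⟩ := Finset.card_eq_three.1 (h3 _ he₁)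
    obtain ⟨x', y', z', -, -, -, rfl⟩ := Finset.card_eq_three.1 (h3 _ he₂)
    rw [Finset.card_eq_zero, ← Finset.disjoint_iff_inter_eq_empty, Finset.disjoint_left] at hi
    simp only [Finset.insert_subset_iff, Finset.singleton_subset_iff] at h₁ h₂
    obtain ⟨s, s1, s2, s3, s4, s5, -⟩ := exists_edge_segment h3 hp h₁.2.1 h₁.2.2 he₁
      (U := {x', y', z'}) (by
        have : (({x', y', z'} : Finset α).card : ℝ) ≤ 3 := by exact_mod_cast Finset.card_le_three
        linarith) (hi (by simp)) (hi (by simp)) (hi (by simp))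
    have s5' := Finset.disjoint_right.1 s5
    obtain ⟨t, t1, t2, t3, t4, t5, -⟩ := exists_edge_segment h3 hp h₂.2.1 h₂.2.2 he₂
      (U := s.l.toFinset) (by
        have : (s.l.toFinset.card : ℝ) ≤ 7 := by
          exact_mod_cast (List.toFinset_card_le _).trans s4
        linarith) (s5' (by simp)) (s5' (by simp)) (s5' (by simp))
    refine ⟨[s, t], by simp [s1, t1], ?_, ?_, ?_⟩
    · simp only [List.flatMap_cons, List.flatMap_nil, List.append_nil, List.nodup_append']
      refine ⟨s3, t3, fun v hv hv' => ?_⟩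
      exact Finset.disjoint_left.1 t5 (List.mem_toFinset.2 hv') (List.mem_toFinset.2 hv)
    · simp only [List.flatMap_cons, List.flatMap_nil, List.append_nil, List.length_append]
      omega
    · simp [s2, t2, h₁.1, h₂.1]
  · obtain ⟨v, hv⟩ := Finset.card_eq_one.1 hi
    have hpair : ∀ e ∈ H, v ∈ e → ∃ x y, e = {v, x, y} := by
      intro e he hve
      have : (e.erase v).card = 2 := by rw [Finset.card_erase_of_mem hve, h3 _ he]
      obtain ⟨x, y, -, hxy⟩ := Finset.card_eq_two.1 this
      exact ⟨x, y, by rw [← hxy, Finset.insert_erase hve]⟩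
    have hv' : v ∈ e₁ ∩ e₂ := by rw [hv]; simp
    rw [Finset.mem_inter] at hv'
    obtain ⟨x, y, rfl⟩ := hpair e₁ he₁ hv'.1
    obtain ⟨x', y', rfl⟩ := hpair e₂ he₂ hv'.2
    obtain ⟨a1, a2, a3⟩ := ne_of_edge_mem h3 he₁
    obtain ⟨b1, b2, b3⟩ := ne_of_edge_mem h3 he₂
    have hmeet : ∀ z, z ∈ ({v, x, y} : Finset α) → z ∈ ({v, x', y'} : Finset α) → z = v := by
      intro z hz hz'
      have : z ∈ ({v} : Finset α) := by rw [← hv]; exact Finset.mem_inter.2 ⟨hz, hz'⟩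
      simpa using this
    have c1 : x ≠ x' := fun h => a1 (hmeet x (by simp) (by simp [h])).symm
    have c2 : x ≠ y' := fun h => a1 (hmeet x (by simp) (by simp [h])).symm
    have c3 : y ≠ x' := fun h => a2 (hmeet y (by simp) (by simp [h])).symm
    have c4 : y ≠ y' := fun h => a2 (hmeet y (by simp) (by simp [h])).symm
    simp only [Finset.insert_subset_iff, Finset.singleton_subset_iff] at h₁ h₂
    obtain ⟨hvB, hx, hy⟩ := h₁
    obtain ⟨-, hx', hy'⟩ := h₂
    have hcard : ∀ T : Finset α, T.card ≤ 6 → (T.card : ℝ) ≤ K := fun T hT => by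
      have : (T.card : ℝ) ≤ 6 := by exact_mod_cast hT
      linarith
    obtain ⟨u, hu, huU, hu'⟩ := hp x hx {v, x, y, x', y'}
      (hcard _ (Finset.card_le_five.trans (by norm_num)))
    obtain ⟨t, ht, htU, ht'⟩ := hp y' hy' {u, v, x, y, x', y'}
      (hcard _ Finset.card_le_six)
    simp only [Finset.mem_insert, Finset.mem_singleton, not_or] at huU htU
    refine ⟨[Segment.double (u := u) (x := x) (v := y) (c := v) (v' := x') (y := y') (u' := t)
      (by convert he₁ using 1; grind) he₂], ?_, ?_, ?_, ?_⟩
    · simp only [List.mem_singleton, forall_eq]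
      exact ⟨hu', ht'⟩
    · simp only [Segment.double, List.flatMap_cons, List.flatMap_nil, List.append_nil,
        List.nodup_cons, List.mem_cons, List.not_mem_nil, or_false, not_or]
      grind
    · simp [Segment.double]
    · simp [excess, Segment.double, hu, hx, hy, hvB, hx', hy', ht]

end Special

section SpecialSegments

variable {α : Type*} [DecidableEq α] {H : Finset (Finset α)}

theorem exists_segments_of_rich (h3 : ∀ e ∈ H, e.card = 3) {A B T : Finset α} {c K : ℝ}
    (hp : HasPartners H A B c K) (hT : ∀ v ∈ T, v ∉ B) (hrich : ∀ v ∈ T, Rich H B v K)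
    (hK : 7 * (T.card : ℝ) + 6 ≤ K) :
    ∃ S : List (Segment H), (∀ s ∈ S, s.Good A c) ∧ (S.flatMap Segment.l).Nodup ∧
      (S.flatMap Segment.l).length ≤ 7 * T.card ∧
      (S.map fun s => excess B s.l).sum = -2 * T.card := by
  obtain ⟨S, hS, hd, -, hQ, -⟩ := exists_disjoint_segments (H := H) (fun v => {v})
    (fun _ s => s.Good A c ∧ excess B s.l = -2) B ∅ (7 * T.card) T
    (by simpa using hT) (by simp) (by simp)
    (by
      intro v hv U hU hvU
      have hUK : (U.card : ℝ) ≤ 7 * T.card := by exact_mod_cast hU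
      obtain ⟨x, hx, y, hy, hxU, hyU, he⟩ := hrich v hv U (by linarith)
      obtain ⟨s, s1, s2, s3, s4, s5, s6⟩ := exists_edge_segment h3 hp hx hy he (by linarith)
        (by simpa using hvU) hxU hyU
      rw [if_neg (hT v hv)] at s2
      exact ⟨s, ⟨s1, s2⟩, s3, s4, s5, by simpa using s6⟩)
    (by simp)
  refine ⟨S, fun s hs => ?_, hd, ?_, ?_⟩
  · obtain ⟨-, -, -, h⟩ := hQ s hs
    exact h.1
  · exact (length_flatMap_le fun s hs => (hQ s hs).1).trans (by rw [hS])
  · rw [sum_excess_eq_mul (e := -2) fun s hs => by obtain ⟨-, -, -, h⟩ := hQ s hs; exact h.2, hS]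
    ring

theorem exists_segments_of_edges (h3 : ∀ e ∈ H, e.card = 3) {A B : Finset α} {c K : ℝ}
    (hp : HasPartners H A B c K) (t : ℕ)
    (hedge : ∀ U : Finset α, U.card ≤ 7 * t → ∃ v ∈ B, ∃ x ∈ B, ∃ y ∈ B,
      v ∉ U ∧ x ∉ U ∧ y ∉ U ∧ ({v, x, y} : Finset α) ∈ H)
    (hK : 7 * (t : ℝ) + 6 ≤ K) :
    ∃ S : List (Segment H), (∀ s ∈ S, s.Good A c) ∧ (S.flatMap Segment.l).Nodup ∧
      (S.flatMap Segment.l).length ≤ 7 * t ∧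
      (S.map fun s => excess B s.l).sum = 2 * t := by
  obtain ⟨S, hS, hd, -, hQ, -⟩ := exists_disjoint_segments (H := H) (fun _ : ℕ => ∅)
    (fun _ s => s.Good A c ∧ excess B s.l = 2) B ∅ (7 * t) (Finset.range t)
    (by simp) (by simp) (by simp)
    (by
      intro i _ U hU _
      have hUK : (U.card : ℝ) ≤ 7 * t := by exact_mod_cast hU
      obtain ⟨v, hv, x, hx, y, hy, hvU, hxU, hyU, he⟩ := hedge U hU
      obtain ⟨s, s1, s2, s3, s4, s5, s6⟩ := exists_edge_segment h3 hp hx hy he (by linarith)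
        hvU hxU hyU
      rw [if_pos hv] at s2
      refine ⟨s, ⟨s1, s2⟩, s3, s4, s5, fun z hz => ?_⟩
      rw [s6 z hz]
      simpa using fun h : z = v => hz (h ▸ hv))
    (by simp)
  rw [Finset.card_range] at hS
  refine ⟨S, fun s hs => ?_, hd, ?_, ?_⟩
  · obtain ⟨-, -, -, h⟩ := hQ s hs
    exact h.1
  · exact (length_flatMap_le fun s hs => (hQ s hs).1).trans (by rw [hS])
  · rw [sum_excess_eq_mul (e := 2) fun s hs => by obtain ⟨-, -, -, h⟩ := hQ s hs; exact h.2, hS]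
    ring

theorem exists_edge_avoiding {B U : Finset α} {d M : ℕ}
    (hlow : ∀ v ∈ B, d ≤ (linkPairs H v B).card) (hhigh : ∀ v ∈ B, (linkPairs H v B).card ≤ M)
    (h : 3 * (U.card * M) < B.card * d) :
    ∃ v ∈ B, ∃ x ∈ B, ∃ y ∈ B, v ∉ U ∧ x ∉ U ∧ y ∉ U ∧ ({v, x, y} : Finset α) ∈ H := by
  by_contra! hcon
  have h1 := sum_card_linkPairs_le_of_cover (H := H) (B := B) (U := U) fun v hv x hx y hy he => by
    by_contra! hU
    exact hcon v hv x hx y hy hU.1 hU.2.1 hU.2.2 he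
  have h2 : B.card * d ≤ ∑ v ∈ B, (linkPairs H v B).card := by
    simpa using Finset.card_nsmul_le_sum B _ _ hlow
  have h3 : ∑ v ∈ B ∩ U, (linkPairs H v B).card ≤ (B ∩ U).card * M := by
    simpa using Finset.sum_le_card_nsmul (B ∩ U) _ _
      fun v hv => hhigh v (Finset.mem_of_mem_inter_left hv)
  have h4 : (B ∩ U).card * M ≤ U.card * M :=
    Nat.mul_le_mul_right _ (Finset.card_le_card Finset.inter_subset_right)
  omega

theorem surplus_bound {n b m D u M : ℝ} (hn : 0 < n) (hD : 1 ≤ D) (hu : u ≤ 28 * D)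
    (hM : M ≤ 2 / 10 ^ 4 * n ^ 2) (hM0 : 0 ≤ M) (hb : 7 / 10 * n ≤ b) (hm : 7 / 10 * n ≤ m) :
    3 * (u * M) < b * (2 * m * D) := by
  have hb0 : 0 ≤ b := by linarith
  have hl : 3 * (u * M) ≤ 3 * ((28 * D) * (2 / 10 ^ 4 * n ^ 2)) := by gcongr
  have hr : (7 / 10 * n) * (2 * (7 / 10 * n) * D) ≤ b * (2 * m * D) := by gcongr
  have hpos : 0 < D * n ^ 2 := by positivity
  linarith

theorem exists_special_segments [Fintype α] (h3 : ∀ e ∈ H, e.card = 3) {n : ℕ}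
    (hcard : Fintype.card α = n) (hn : Even n) (hn0 : 10 ^ 9 ≤ n) {B : Finset α}
    (hB : |(B.card : ℝ) - 3 / 4 * n| ≤ n / 10 ^ 8)
    (hdeg : ∀ v ∈ B, (B.card - 1) * (B.card - 2) + 2 * (if 4 ∣ n then 2 else 1) ≤
      (linkPairs H v B).card + (3 * n / 4) * (3 * n / 4 - 1))
    (hmax : ∀ v ∈ B, ((linkPairs H v B).card : ℝ) ≤ 2 / 10 ^ 4 * (n : ℝ) ^ 2)
    (hp : HasPartners H Bᶜ B (n / 40) (7 / 10 * n))
    (hrich : ∀ v ∉ B, Rich H B v (n / 10 ^ 5)) :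
    ∃ S : List (Segment H), (∀ s ∈ S, s.Good Bᶜ (n / 40)) ∧ (S.flatMap Segment.l).Nodup ∧
      ((S.flatMap Segment.l).length : ℝ) ≤ n / 10 ^ 6 ∧
      (S.map fun s => excess B s.l).sum = (B.card : ℤ) - 3 * (Bᶜ.card : ℤ) := by
  have hnR : (10 : ℝ) ^ 9 ≤ n := by exact_mod_cast hn0
  rw [abs_le] at hB
  have hBc : B.card + Bᶜ.card = n := by rw [Finset.card_add_card_compl, hcard]
  rcases le_or_gt (4 * B.card) (3 * n) with hle | hlt
  · obtain ⟨t, ht⟩ : ∃ t, 3 * n = 4 * B.card + 2 * t := ⟨(3 * n - 4 * B.card) / 2, by grind⟩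
    have htR : (3 * n : ℝ) = 4 * B.card + 2 * t := by exact_mod_cast ht
    obtain ⟨T, hTB, hTc⟩ := Finset.exists_subset_card_eq (s := Bᶜ) (n := t) (by
      have hBcR : (B.card : ℝ) + Bᶜ.card = n := by exact_mod_cast hBc
      have : (t : ℝ) ≤ Bᶜ.card := by linarith
      exact_mod_cast this)
    have hT : ∀ v ∈ T, v ∉ B := fun v hv => Finset.mem_compl.1 (hTB hv)
    obtain ⟨S, h1, h2, h4, h5⟩ := exists_segments_of_rich h3 (T := T) (K := n / 10 ^ 5)
      (hp.mono (by linarith)) hT (fun v hv => hrich v (hT v hv)) (by rw [hTc]; linarith)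
    refine ⟨S, h1, h2, ?_, ?_⟩
    · rw [hTc] at h4
      have : ((S.flatMap Segment.l).length : ℝ) ≤ 7 * t := by exact_mod_cast h4
      linarith
    · rw [h5, hTc]; omega
  · obtain ⟨t, ht⟩ : ∃ t, 4 * B.card = 3 * n + 2 * t := ⟨(4 * B.card - 3 * n) / 2, by grind⟩
    have htR : (4 * B.card : ℝ) = 3 * n + 2 * t := by exact_mod_cast ht
    set m := 3 * n / 4 with hm
    obtain ⟨D, hD⟩ : ∃ D, B.card = m + 1 + D := ⟨B.card - (m + 1), by omega⟩
    have ht0 : 0 < t := by omega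
    suffices h : ∃ S : List (Segment H), (∀ s ∈ S, s.Good Bᶜ (n / 40)) ∧
        (S.flatMap Segment.l).Nodup ∧ (S.flatMap Segment.l).length ≤ 7 * t ∧
        (S.map fun s => excess B s.l).sum = 2 * t by
      obtain ⟨S, h1, h2, h4, h5⟩ := h
      refine ⟨S, h1, h2, ?_, by rw [h5]; omega⟩
      have : ((S.flatMap Segment.l).length : ℝ) ≤ 7 * t := by exact_mod_cast h4
      linarith
    rcases Nat.eq_zero_or_pos D with rfl | hD0
    · have hlink : ∀ v ∈ B, 2 * (if 4 ∣ n then 2 else 1) ≤ (linkPairs H v B).card := by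
        intro v hv
        have := hdeg v hv
        rw [hD] at this
        simp only [add_zero, Nat.add_sub_cancel] at this
        rw [show m + 1 - 2 = m - 1 by omega] at this
        omega
      obtain ⟨k, hk⟩ := hn
      by_cases h4 : 4 ∣ n
      · have ht2 : t = 2 := by omega
        simp only [h4, if_true] at hlink
        obtain ⟨e₁, he₁, e₂, he₂, hi⟩ := exists_edges_inter_card_le_one
          (F := H.filter (· ⊆ B)) (B := B) (fun e he => h3 e (Finset.mem_filter.1 he).1)
          (by omega) fun v hv => exists_two_edges_of_linkPairs h3 hv (hlink v hv)
        rw [Finset.mem_filter] at he₁ he₂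
        obtain ⟨S, h1, h2, h5, h6⟩ := exists_segments_of_two_edges h3 hp (by linarith)
          he₁.1 he₂.1 he₁.2 he₂.2 hi
        exact ⟨S, h1, h2, by omega, by rw [h6, ht2]; norm_num⟩
      · have ht1 : t = 1 := by omega
        simp only [h4, if_false] at hlink
        obtain ⟨v, hv⟩ : B.Nonempty := Finset.card_pos.1 (by omega)
        obtain ⟨⟨x, y⟩, hxy⟩ : (linkPairs H v B).Nonempty :=
          Finset.card_pos.1 (by have := hlink v hv; omega)
        obtain ⟨⟨hx, hy⟩, he⟩ := mem_linkPairs.1 hxy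
        obtain ⟨s, s1, s2, s3, s4, -⟩ := exists_edge_segment h3 hp (U := ∅) hx hy he
          (by simp; linarith) (by simp) (by simp) (by simp)
        refine ⟨[s], by simpa using s1, by simpa using s3, by simpa [ht1] using s4, ?_⟩
        simp [s2, hv, ht1]
    · refine exists_segments_of_edges h3 hp t (fun U hU => ?_) (by linarith)
      refine exists_edge_avoiding (d := 2 * m * D) (M := ⌊2 / 10 ^ 4 * (n : ℝ) ^ 2⌋₊)
        (fun v hv => ?_) (fun v hv => Nat.le_floor (hmax v hv)) ?_
      · have := hdeg v hv
        rw [hD, show m + 1 + D - 1 = m + D by omega,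
          show m + 1 + D - 2 = m + D - 1 by omega] at this
        obtain ⟨m', hm'⟩ : ∃ m', m = m' + 1 := ⟨m - 1, by omega⟩
        rw [hm'] at this ⊢
        rw [show m' + 1 + D - 1 = m' + D by omega, Nat.add_sub_cancel] at this
        generalize (if 4 ∣ n then 2 else 1) = c at this
        have hDD : D ≤ D * D := Nat.le_mul_self D
        linarith [Nat.zero_le c]
      · have hUR : (U.card : ℝ) ≤ 7 * t := by exact_mod_cast hU
        have htD : (t : ℝ) ≤ 2 * D + 2 := by
          have : t ≤ 2 * D + 2 := by omega
          exact_mod_cast this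
        have hD1 : (1 : ℝ) ≤ D := by exact_mod_cast hD0
        have hM : ((⌊2 / 10 ^ 4 * (n : ℝ) ^ 2⌋₊ : ℕ) : ℝ) ≤ 2 / 10 ^ 4 * (n : ℝ) ^ 2 :=
          Nat.floor_le (by positivity)
        have hmR : (7 / 10 : ℝ) * n ≤ m := by
          have : 7 * n ≤ 10 * m := by omega
          have : (7 * n : ℝ) ≤ 10 * m := by exact_mod_cast this
          linarith
        have hbR : (7 / 10 : ℝ) * n ≤ B.card := by linarith
        exact_mod_cast surplus_bound (by positivity) hD1 (hUR.trans (by linarith)) hM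
          (Nat.cast_nonneg _) hbR hmR

end SpecialSegments

section Counting

variable {α : Type*} [DecidableEq α] {H : Finset (Finset α)}

/-- The ordered pairs of distinct vertices of `S`, both different from `v`, that do not form an
edge with `v`. -/
def missPairs (H : Finset (Finset α)) (v : α) (S : Finset α) : Finset (α × α) :=
  (S.erase v).offDiag.filter fun p => ({v, p.1, p.2} : Finset α) ∉ H

theorem mem_missPairs {v : α} {S : Finset α} {p : α × α} :
    p ∈ missPairs H v S ↔ ((p.1 ≠ v ∧ p.1 ∈ S) ∧ (p.2 ≠ v ∧ p.2 ∈ S) ∧ p.1 ≠ p.2) ∧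
      ({v, p.1, p.2} : Finset α) ∉ H := by
  simp [missPairs]

theorem card_linkPairs_add_card_missPairs (h3 : ∀ e ∈ H, e.card = 3) (v : α) (S : Finset α) :
    (linkPairs H v S).card + (missPairs H v S).card =
      (S.erase v).card * ((S.erase v).card - 1) := by
  have h : linkPairs H v S =
      (S.erase v).offDiag.filter fun p => ({v, p.1, p.2} : Finset α) ∈ H := by
    ext p
    rw [mem_linkPairs, Finset.mem_filter, Finset.mem_offDiag, Finset.mem_erase, Finset.mem_erase]
    constructor
    · rintro ⟨⟨hx, hy⟩, he⟩
      obtain ⟨h1, h2, h3⟩ := ne_of_edge_mem h3 he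
      exact ⟨⟨⟨h1.symm, hx⟩, ⟨h2.symm, hy⟩, h3⟩, he⟩
    · rintro ⟨⟨hx, hy, -⟩, he⟩
      exact ⟨⟨hx.2, hy.2⟩, he⟩
  rw [h, missPairs, Finset.card_filter_add_card_filter_not, Finset.offDiag_card,
    Nat.mul_sub, Nat.mul_one]

theorem card_linkPairs_le_add [Fintype α] (v : α) (S T : Finset α) :
    (linkPairs H v S).card ≤ (linkPairs H v T).card + 2 * ((S \ T).card * Fintype.card α) := by
  have hsub : linkPairs H v S ⊆
      linkPairs H v T ∪ ((S \ T) ×ˢ Finset.univ ∪ Finset.univ ×ˢ (S \ T)) := by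
    intro p hp
    rw [mem_linkPairs] at hp
    simp only [Finset.mem_union, mem_linkPairs, Finset.mem_product, Finset.mem_sdiff,
      Finset.mem_univ, and_true, true_and]
    tauto
  refine (Finset.card_le_card hsub).trans ((Finset.card_union_le _ _).trans ?_)
  refine Nat.add_le_add_left ((Finset.card_union_le _ _).trans ?_) _
  rw [Finset.card_product, Finset.card_product, Finset.card_univ]
  exact le_of_eq (by ring)

theorem two_mul_hdeg_le [Fintype α] (h3 : ∀ e ∈ H, e.card = 3) (v : α) :
    2 * hdeg H v ≤ (linkPairs H v Finset.univ).card := by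
  refine Finset.mul_card_image_le_card_of_maps_to (f := fun p => {v, p.1, p.2})
    (fun p hp => ?_) 2 fun e he => ?_
  · exact Finset.mem_filter.2 ⟨(mem_linkPairs.1 hp).2, by simp⟩
  · obtain ⟨he, hv⟩ := Finset.mem_filter.1 he
    obtain ⟨x, y, hxy, hp⟩ := Finset.card_eq_two.1
      (show (e.erase v).card = 2 by rw [Finset.card_erase_of_mem hv, h3 e he])
    have hexy : ({v, x, y} : Finset α) = e := by rw [← hp, Finset.insert_erase hv]
    have heyx : ({v, y, x} : Finset α) = e := by rw [← hexy, Finset.pair_comm]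
    rw [← Finset.card_pair (a := (x, y)) (b := (y, x)) (by simp [hxy])]
    refine Finset.card_le_card ?_
    simp [Finset.insert_subset_iff, mem_linkPairs, hexy, heyx, he]

theorem sum_card_linkPairs_le (h3 : ∀ e ∈ H, e.card = 3) (B : Finset α) :
    ∑ v ∈ B, (linkPairs H v B).card ≤ 27 * eIn H B := by
  rw [← Finset.card_sigma, eIn, mul_comm]
  have hsub : (B.sigma fun v => linkPairs H v B) ⊆ (H.filter (· ⊆ B)).biUnion fun e =>
      e.sigma fun _ => e ×ˢ e := by
    rintro ⟨v, x, y⟩ hq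
    simp only [Finset.mem_sigma, mem_linkPairs] at hq
    obtain ⟨hv, ⟨hx, hy⟩, he⟩ := hq
    refine Finset.mem_biUnion.2 ⟨_, Finset.mem_filter.2 ⟨he, ?_⟩, by simp⟩
    simp [Finset.insert_subset_iff, hv, hx, hy]
  refine (Finset.card_le_card hsub).trans (Finset.card_biUnion_le_card_mul _ _ _ fun e he => ?_)
  rw [Finset.card_sigma]
  simp [h3 e (Finset.mem_filter.1 he).1]

theorem sum_pairMiss_add_card_missPairs_le [Fintype α] (v : α) (B : Finset α) (hv : v ∈ B) :
    ∑ y ∈ B.erase v, pairMiss H Bᶜ v y + (missPairs H v B).card ≤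
      (missPairs H v Finset.univ).card := by
  have h : ∑ y ∈ B.erase v, pairMiss H Bᶜ v y =
      (((B.erase v).sigma fun y => Bᶜ.filter fun a => ({a, v, y} : Finset α) ∉ H).image
        fun q => (q.1, q.2)).card := by
    rw [Finset.card_image_of_injective _ (by rintro ⟨a, b⟩ ⟨c, d⟩ h; simpa using h),
      Finset.card_sigma]
    rfl
  rw [h, ← Finset.card_union_of_disjoint]
  · refine Finset.card_le_card (Finset.union_subset ?_ ?_)
    · intro p hp
      simp only [Finset.mem_image, Finset.mem_sigma, Finset.mem_erase, Finset.mem_filter,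
        Finset.mem_compl] at hp
      obtain ⟨⟨y, a⟩, ⟨hy, ha, he⟩, rfl⟩ := hp
      rw [mem_missPairs]
      refine ⟨⟨⟨hy.1, Finset.mem_univ _⟩, ⟨fun h : a = v => ha (h ▸ hv), Finset.mem_univ _⟩,
        fun h : y = a => ha (h ▸ hy.2)⟩, ?_⟩
      convert he using 2
      grind
    · intro p hp
      rw [mem_missPairs] at hp ⊢
      simpa using ⟨⟨hp.1.1.1, hp.1.2.1.1, hp.1.2.2⟩, hp.2⟩
  · rw [Finset.disjoint_left]
    intro p hp hp'
    rw [mem_missPairs] at hp'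
    simp only [Finset.mem_image, Finset.mem_sigma, Finset.mem_erase, Finset.mem_filter,
        Finset.mem_compl] at hp
    obtain ⟨⟨y, a⟩, ⟨hy, ha, he⟩, rfl⟩ := hp
    exact ha hp'.1.2.1.2

theorem sum_card_missPairs_compl [Fintype α] (B : Finset α) :
    ∑ a ∈ Bᶜ, (missPairs H a B).card = ∑ v ∈ B, ∑ y ∈ B.erase v, pairMiss H Bᶜ v y := by
  have h1 : ∀ a ∈ Bᶜ, (missPairs H a B).card =
      ∑ v ∈ B, ∑ y ∈ B.erase v, if ({a, v, y} : Finset α) ∉ H then 1 else 0 := by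
    intro a ha
    rw [missPairs, Finset.card_filter, Finset.erase_eq_of_notMem (Finset.mem_compl.1 ha),
      Finset.sum_sigma']
    refine Finset.sum_bij' (fun p _ => ⟨p.1, p.2⟩) (fun q _ => (q.1, q.2)) ?_ ?_ ?_ ?_ ?_
    · simp +contextual [eq_comm]
    · simp +contextual [eq_comm]
    · simp
    · simp
    · simp
  rw [Finset.sum_congr rfl h1, Finset.sum_comm]
  refine Finset.sum_congr rfl fun v _ => ?_
  rw [Finset.sum_comm]
  refine Finset.sum_congr rfl fun y _ => ?_
  rw [pairMiss, Finset.card_filter]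

theorem card_filter_not_pairMiss_le {A B : Finset α} {x : α} {c w r : ℝ} (hc : 0 < c)
    (hw : ((∑ y ∈ B.erase x, pairMiss H A x y : ℕ) : ℝ) ≤ w) (hr : w / c + 1 ≤ r) :
    ((B.filter fun y => ¬ (x ≠ y ∧ (pairMiss H A x y : ℝ) ≤ c)).card : ℝ) ≤ r := by
  set F := (B.erase x).filter fun y => c < pairMiss H A x y with hF
  have hsub : (B.filter fun y => ¬ (x ≠ y ∧ (pairMiss H A x y : ℝ) ≤ c)) ⊆ insert x F := by
    intro y hy
    rw [Finset.mem_filter] at hy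
    rw [Finset.mem_insert, hF, Finset.mem_filter, Finset.mem_erase]
    by_cases h : y = x
    · exact Or.inl h
    · exact Or.inr ⟨⟨h, hy.1⟩, lt_of_not_ge fun h' => hy.2 ⟨fun h'' => h h''.symm, h'⟩⟩
  have h1 : ((B.filter fun y => ¬ (x ≠ y ∧ (pairMiss H A x y : ℝ) ≤ c)).card : ℝ) ≤ F.card + 1 := by
    exact_mod_cast (Finset.card_le_card hsub).trans (Finset.card_insert_le _ _)
  have h2 : F.card * c ≤ w := by
    refine le_trans ?_ hw
    push_cast
    calc (F.card : ℝ) * c = ∑ y ∈ F, c := by simp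
      _ ≤ ∑ y ∈ F, (pairMiss H A x y : ℝ) :=
        Finset.sum_le_sum fun y hy => (Finset.mem_filter.1 hy).2.le
      _ ≤ _ := Finset.sum_le_sum_of_subset_of_nonneg (Finset.filter_subset _ _)
        fun _ _ _ => Nat.cast_nonneg _
  have h3 : (F.card : ℝ) ≤ w / c := by rwa [le_div_iff₀ hc]
  linarith

theorem rich_of_card_linkPairs [Fintype α] {B : Finset α} {v : α} {K : ℝ}
    (h : 2 * K * Fintype.card α < (linkPairs H v B).card) : Rich H B v K := by
  intro U hU
  have h1 := card_linkPairs_le_add (H := H) v B (B \ U)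
  have h2 : ((B \ (B \ U)).card : ℝ) ≤ K := by
    refine le_trans ?_ hU
    exact_mod_cast Finset.card_le_card (by grind : B \ (B \ U) ⊆ U)
  have h3 : ((linkPairs H v B).card : ℝ) ≤ (linkPairs H v (B \ U)).card +
      2 * (((B \ (B \ U)).card : ℝ) * Fintype.card α) := by exact_mod_cast h1
  have h4 : ((B \ (B \ U)).card : ℝ) * Fintype.card α ≤ K * Fintype.card α := by gcongr
  have h5 : (0 : ℝ) < (linkPairs H v (B \ U)).card := by linarith
  obtain ⟨⟨x, y⟩, hxy⟩ := Finset.card_pos.1 (Nat.cast_pos.1 h5)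
  simp only [mem_linkPairs, Finset.mem_sdiff] at hxy
  exact ⟨x, hxy.1.1.1, y, hxy.1.2.1, hxy.1.1.2, hxy.1.2.2, hxy.2⟩

theorem rich_of_card_missPairs {B : Finset α} {v : α} {K r : ℝ} (hv : v ∉ B) (hr : 1 ≤ r)
    (hK : K + r ≤ B.card) (h : ((missPairs H v B).card : ℝ) < r * (r - 1)) : Rich H B v K := by
  intro U hU
  by_contra! hcon
  have hc : r ≤ (B \ U).card := by
    have h1 := Finset.le_card_sdiff U B
    have h2 : (B.card : ℝ) ≤ (B \ U).card + U.card := by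
      exact_mod_cast (by omega : B.card ≤ (B \ U).card + U.card)
    linarith
  have hsub : (B \ U).offDiag ⊆ missPairs H v B := by
    intro p hp
    simp only [Finset.mem_offDiag, Finset.mem_sdiff] at hp
    rw [mem_missPairs]
    exact ⟨⟨⟨fun h => hv (h ▸ hp.1.1), hp.1.1⟩, ⟨fun h => hv (h ▸ hp.2.1.1), hp.2.1.1⟩, hp.2.2⟩,
      hcon _ hp.1.1 _ hp.2.1.1 hp.1.2 hp.2.1.2⟩
  have h1 := Finset.card_le_card hsub
  rw [Finset.offDiag_card] at h1
  have h2 : ((B \ U).card : ℝ) * (B \ U).card ≤ (missPairs H v B).card + (B \ U).card := by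
    exact_mod_cast (by omega)
  nlinarith

end Counting

section Extremal

variable {α : Type*} [DecidableEq α] [Fintype α] {H : Finset (Finset α)}

theorem sum_pairMiss_add_le (h3 : ∀ e ∈ H, e.card = 3) {B : Finset α} {v : α} (hv : v ∈ B)
    {c M : ℕ} (hmiss : (missPairs H v Finset.univ).card + c ≤ M) :
    ∑ y ∈ B.erase v, pairMiss H Bᶜ v y + (B.card - 1) * (B.card - 2) + c ≤
      (linkPairs H v B).card + M := by
  have h1 := sum_pairMiss_add_card_missPairs_le (H := H) v B hv
  have h2 := card_linkPairs_add_card_missPairs h3 v B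
  rw [Finset.card_erase_of_mem hv, Nat.sub_sub, one_add_one_eq_two] at h2
  omega

theorem sum_card_missPairs_compl_le (h3 : ∀ e ∈ H, e.card = 3) {B : Finset α} {m : ℕ}
    (hB : B.card = m) (hmiss : ∀ v, (missPairs H v Finset.univ).card ≤ m * (m - 1)) :
    ∑ a ∈ Bᶜ, (missPairs H a B).card ≤ ∑ v ∈ B, (linkPairs H v B).card + 2 * m ^ 2 := by
  rw [sum_card_missPairs_compl]
  have h : ∀ v ∈ B, ∑ y ∈ B.erase v, pairMiss H Bᶜ v y ≤ (linkPairs H v B).card + 2 * m := by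
    intro v hv
    have h1 := sum_pairMiss_add_le h3 hv (c := 0) (hmiss v)
    have hm : 0 < m := by rw [← hB]; exact Finset.card_pos.2 ⟨v, hv⟩
    rw [hB] at h1
    obtain ⟨k, rfl⟩ : ∃ k, m = k + 1 := ⟨m - 1, by omega⟩
    rw [Nat.add_sub_cancel, show k + 1 - 2 = k - 1 by omega] at h1
    have h2 : (k + 1) * k ≤ k * (k - 1) + 2 * (k + 1) := by
      cases k with
      | zero => simp
      | succ k => rw [Nat.add_sub_cancel]; nlinarith
    omega
  refine (Finset.sum_le_sum h).trans ?_
  rw [Finset.sum_add_distrib, Finset.sum_const, hB, smul_eq_mul]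
  exact le_of_eq (by ring)

theorem card_mul_le_of_le_sum {ι : Type*} {s t : Finset ι} {f : ι → ℕ} {b W : ℝ} (hst : s ⊆ t)
    (hs : ∀ i ∈ s, b ≤ f i) (ht : ((∑ i ∈ t, f i : ℕ) : ℝ) ≤ W) : s.card * b ≤ W := by
  refine le_trans ?_ ht
  push_cast
  calc (s.card : ℝ) * b = ∑ i ∈ s, b := by simp
    _ ≤ ∑ i ∈ s, (f i : ℝ) := Finset.sum_le_sum hs
    _ ≤ _ := Finset.sum_le_sum_of_subset_of_nonneg hst fun _ _ _ => Nat.cast_nonneg _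

theorem exists_stable_set (h3 : ∀ e ∈ H, e.card = 3) {n : ℕ} (hcard : Fintype.card α = n)
    (hn0 : 10 ^ 20 ≤ n) {B₀ : Finset α} (hB₀ : B₀.card = 3 * n / 4)
    (hmiss : ∀ v, (missPairs H v Finset.univ).card ≤ (3 * n / 4) * (3 * n / 4 - 1))
    (hsum : ((∑ v ∈ B₀, (linkPairs H v B₀).card : ℕ) : ℝ) ≤ (n : ℝ) ^ 3 / 10 ^ 16) :
    ∃ B : Finset α, |(B.card : ℝ) - 3 / 4 * n| ≤ n / 10 ^ 11 ∧
      (∀ v ∈ B, ((linkPairs H v B).card : ℝ) ≤ 2 / 10 ^ 4 * (n : ℝ) ^ 2) ∧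
      (∀ v ∉ B, 5 / 10 ^ 5 * (n : ℝ) ^ 2 ≤ (linkPairs H v B).card) ∧
      ((∑ v ∈ B, (linkPairs H v B).card : ℕ) : ℝ) ≤ (n : ℝ) ^ 3 / 10 ^ 11 := by
  have hnR : (10 : ℝ) ^ 20 ≤ n := by exact_mod_cast hn0
  set m := 3 * n / 4 with hm
  have hm1 : (3 / 4 : ℝ) * n - 1 ≤ m := by
    have : 3 * n ≤ 4 * m + 3 := by omega
    have : (3 * n : ℝ) ≤ 4 * m + 3 := by exact_mod_cast this
    linarith
  have hm2 : (m : ℝ) ≤ 3 / 4 * n := by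
    have : 4 * m ≤ 3 * n := by omega
    have : (4 * m : ℝ) ≤ 3 * n := by exact_mod_cast this
    linarith
  set B := Finset.univ.filter fun v => ((linkPairs H v B₀).card : ℝ) ≤ (n : ℝ) ^ 2 / 10 ^ 4 with hB
  have hnpos : (0 : ℝ) < n := by linarith
  have hn2 : (10 : ℝ) ^ 20 * n ≤ (n : ℝ) ^ 2 := by nlinarith
  have hn3 : (10 : ℝ) ^ 20 * (n : ℝ) ^ 2 ≤ (n : ℝ) ^ 3 := by
    rw [pow_succ (n : ℝ) 2, mul_comm]; gcongr
  have hout : ((B₀ \ B).card : ℝ) ≤ n / 10 ^ 12 := by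
    have h := card_mul_le_of_le_sum (s := B₀ \ B) (b := (n : ℝ) ^ 2 / 10 ^ 4) Finset.sdiff_subset
      (fun v hv => by
        simp only [hB, Finset.mem_sdiff, Finset.mem_filter, Finset.mem_univ, true_and, not_le] at hv
        exact hv.2.le) hsum
    refine le_of_mul_le_mul_right (h.trans (le_of_eq ?_)) (by positivity : 0 < (n : ℝ) ^ 2 / 10 ^ 4)
    ring
  have hin : ((B \ B₀).card : ℝ) ≤ n / 10 ^ 12 := by
    have h1 : ((∑ a ∈ B₀ᶜ, (missPairs H a B₀).card : ℕ) : ℝ) ≤ 2 * (n : ℝ) ^ 3 / 10 ^ 16 := by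
      have h : ((∑ a ∈ B₀ᶜ, (missPairs H a B₀).card : ℕ) : ℝ) ≤
          (∑ v ∈ B₀, (linkPairs H v B₀).card : ℕ) + 2 * (m : ℝ) ^ 2 := by
        exact_mod_cast sum_card_missPairs_compl_le h3 hB₀ hmiss
      have hm3 : (m : ℝ) ^ 2 ≤ (n : ℝ) ^ 2 :=
        pow_le_pow_left₀ (Nat.cast_nonneg _) (by linarith) 2
      linarith
    have h := card_mul_le_of_le_sum (s := B \ B₀) (b := (n : ℝ) ^ 2 / 4)
      (fun v hv => Finset.mem_compl.2 (Finset.mem_sdiff.1 hv).2)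
      (fun v hv => by
        simp only [hB, Finset.mem_sdiff, Finset.mem_filter, Finset.mem_univ, true_and] at hv
        have h2 := card_linkPairs_add_card_missPairs h3 v B₀
        rw [Finset.erase_eq_of_notMem hv.2, hB₀] at h2
        have h3 : (m : ℝ) * m ≤ (linkPairs H v B₀).card + (missPairs H v B₀).card + m := by
          have : m * m = m * (m - 1) + m := by
            obtain ⟨k, hk⟩ : ∃ k, m = k + 1 := ⟨m - 1, by omega⟩
            rw [hk, Nat.add_sub_cancel]; ring
          exact_mod_cast (by omega)
        have h4 : (7 / 10 * n) * (7 / 10 * n) ≤ (m : ℝ) * m := by gcongr <;> linarith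
        nlinarith [hv.1]) h1
    refine le_of_mul_le_mul_right (h.trans ?_) (by positivity : 0 < (n : ℝ) ^ 2 / 4)
    have : 0 < (n : ℝ) ^ 3 := by positivity
    rw [show (n : ℝ) / 10 ^ 12 * ((n : ℝ) ^ 2 / 4) = (n : ℝ) ^ 3 / (4 * 10 ^ 12) by ring]
    linarith
  have hBc : (B.card : ℝ) + (B₀ \ B).card = m + (B \ B₀).card := by
    rw [← hB₀]
    have h1 := Finset.card_inter_add_card_sdiff B B₀
    have h2 := Finset.card_inter_add_card_sdiff B₀ B
    rw [Finset.inter_comm] at h2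
    exact_mod_cast (by omega)
  have hle : ∀ v, ((linkPairs H v B).card : ℝ) ≤ (linkPairs H v B₀).card +
      2 / 10 ^ 12 * (n : ℝ) ^ 2 := by
    intro v
    have h : ((linkPairs H v B).card : ℝ) ≤ (linkPairs H v B₀).card + 2 * ((B \ B₀).card * n) := by
      rw [← hcard]; exact_mod_cast card_linkPairs_le_add v B B₀
    nlinarith
  refine ⟨B, ?_, fun v hv => ?_, fun v hv => ?_, ?_⟩
  · have : (0 : ℝ) ≤ (B \ B₀).card := Nat.cast_nonneg _
    have : (0 : ℝ) ≤ (B₀ \ B).card := Nat.cast_nonneg _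
    rw [abs_le]
    constructor <;> linarith
  · have h := hle v
    simp only [hB, Finset.mem_filter, Finset.mem_univ, true_and] at hv
    have : 0 < (n : ℝ) ^ 2 := by positivity
    linarith
  · simp only [hB, Finset.mem_filter, Finset.mem_univ, true_and, not_le] at hv
    have h : ((linkPairs H v B₀).card : ℝ) ≤ (linkPairs H v B).card + 2 * ((B₀ \ B).card * n) := by
      rw [← hcard]; exact_mod_cast card_linkPairs_le_add v B₀ B
    nlinarith
  · push_cast at hsum ⊢
    have h1 : ∀ v ∈ B, ((linkPairs H v B).card : ℝ) ≤
        (linkPairs H v B₀).card + 2 / 10 ^ 12 * (n : ℝ) ^ 2 := fun v _ => hle v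
    have h2 := Finset.sum_le_sum h1
    rw [Finset.sum_add_distrib, Finset.sum_const, nsmul_eq_mul] at h2
    have h3 : ∑ v ∈ B, ((linkPairs H v B₀).card : ℝ) ≤
        ∑ v ∈ B₀, ((linkPairs H v B₀).card : ℝ) + ∑ v ∈ B \ B₀, ((linkPairs H v B₀).card : ℝ) := by
      rw [← Finset.sum_union Finset.disjoint_sdiff, Finset.union_sdiff_self_eq_union]
      exact Finset.sum_le_sum_of_subset_of_nonneg Finset.subset_union_right
        fun _ _ _ => Nat.cast_nonneg _
    have h4 : ∑ v ∈ B \ B₀, ((linkPairs H v B₀).card : ℝ) ≤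
        (B \ B₀).card * ((n : ℝ) ^ 2 / 10 ^ 4) := by
      rw [← nsmul_eq_mul]
      refine Finset.sum_le_card_nsmul _ _ _ fun v hv => ?_
      simp only [hB, Finset.mem_sdiff, Finset.mem_filter, Finset.mem_univ, true_and] at hv
      exact hv.1
    have h5 : (B \ B₀).card * ((n : ℝ) ^ 2 / 10 ^ 4) ≤ n / 10 ^ 12 * ((n : ℝ) ^ 2 / 10 ^ 4) := by
      gcongr
    have h6 : (B.card : ℝ) * (2 / 10 ^ 12 * (n : ℝ) ^ 2) ≤ n * (2 / 10 ^ 12 * (n : ℝ) ^ 2) := by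
      gcongr
      exact_mod_cast hcard ▸ Finset.card_le_univ B
    have : 0 < (n : ℝ) ^ 3 := by positivity
    rw [show n / 10 ^ 12 * ((n : ℝ) ^ 2 / 10 ^ 4) = (n : ℝ) ^ 3 / 10 ^ 16 by ring] at h5
    rw [show (n : ℝ) * (2 / 10 ^ 12 * (n : ℝ) ^ 2) = 2 / 10 ^ 12 * (n : ℝ) ^ 3 by ring] at h6
    linarith

end Extremal

section Main

theorem card_missPairs_add_le {α : Type*} [DecidableEq α] [Fintype α] {H : Finset (Finset α)}
    (h3 : ∀ e ∈ H, e.card = 3) {n m c : ℕ} (hcard : Fintype.card α = n) {v : α}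
    (hdeg : (n - 1).choose 2 - m.choose 2 + c ≤ hdeg H v) :
    (missPairs H v Finset.univ).card + 2 * c ≤ m * (m - 1) := by
  have h1 := two_mul_hdeg_le h3 v
  have h2 := card_linkPairs_add_card_missPairs h3 v Finset.univ
  rw [Finset.card_erase_of_mem (Finset.mem_univ v), Finset.card_univ, hcard] at h2
  have h4 : ∀ k : ℕ, 2 * k.choose 2 = k * (k - 1) := fun k => by
    rw [Nat.choose_two_right, Nat.mul_div_cancel' (Nat.even_mul_pred_self k).two_dvd]
  have h5 := h4 (n - 1)
  have h6 := h4 m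
  omega

theorem exists_loose_cycle_of_stable_set {α : Type*} [DecidableEq α] [Fintype α]
    {H : Finset (Finset α)} (h3 : ∀ e ∈ H, e.card = 3) {n : ℕ} (hcard : Fintype.card α = n)
    (hn : Even n) (hn0 : 10 ^ 20 ≤ n) {B : Finset α}
    (hmiss : ∀ v, (missPairs H v Finset.univ).card + 2 * (if 4 ∣ n then 2 else 1) ≤
      (3 * n / 4) * (3 * n / 4 - 1))
    (hB : |(B.card : ℝ) - 3 / 4 * n| ≤ n / 10 ^ 11)
    (hmax : ∀ v ∈ B, ((linkPairs H v B).card : ℝ) ≤ 2 / 10 ^ 4 * (n : ℝ) ^ 2)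
    (hmin : ∀ v ∉ B, 5 / 10 ^ 5 * (n : ℝ) ^ 2 ≤ (linkPairs H v B).card)
    (hsum : ((∑ v ∈ B, (linkPairs H v B).card : ℕ) : ℝ) ≤ (n : ℝ) ^ 3 / 10 ^ 11) :
    ∃ a l, (a :: l).Nodup ∧ (a :: l).toFinset = Finset.univ ∧ IsLoosePath H (a :: l ++ [a]) := by
  have hnR : (10 : ℝ) ^ 20 ≤ n := by exact_mod_cast hn0
  have hnpos : (0 : ℝ) < n := by linarith
  have hn2 : (10 : ℝ) ^ 20 * n ≤ (n : ℝ) ^ 2 := by nlinarith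
  have hn2pos : 0 < (n : ℝ) ^ 2 := by positivity
  obtain ⟨hB1, hB2⟩ := abs_le.1 hB
  set w : α → ℕ := fun v => ∑ y ∈ B.erase v, pairMiss H Bᶜ v y with hw
  have hw1 : ∀ v ∈ B, (w v : ℝ) ≤ (linkPairs H v B).card + (n : ℝ) ^ 2 / 10 ^ 10 := by
    intro v hv
    have h := sum_pairMiss_add_le h3 hv (hmiss v)
    have h' : ((w v : ℕ) : ℝ) + ((B.card : ℝ) - 1) * (B.card - 2) ≤
        (linkPairs H v B).card + 3 / 4 * n * (3 / 4 * n) := by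
      have hb : 2 ≤ B.card := by
        have : (2 : ℝ) ≤ B.card := by linarith
        exact_mod_cast this
      have hm : ((3 * n / 4 : ℕ) : ℝ) ≤ 3 / 4 * n := by
        have : 4 * (3 * n / 4) ≤ 3 * n := Nat.mul_div_le _ _
        have : (4 * (3 * n / 4 : ℕ) : ℝ) ≤ 3 * n := by exact_mod_cast this
        linarith
      have hmm : ((3 * n / 4 : ℕ) : ℝ) * (3 * n / 4 : ℕ) ≤ 3 / 4 * n * (3 / 4 * n) := by gcongr
      have h1 : w v + (B.card - 1) * (B.card - 2) ≤
          (linkPairs H v B).card + (3 * n / 4) * (3 * n / 4) :=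
        (Nat.le_add_right _ _).trans (h.trans (by gcongr; exact Nat.sub_le _ _))
      have h2 : ((w v : ℕ) : ℝ) + ((B.card - 1 : ℕ) : ℝ) * ((B.card - 2 : ℕ) : ℝ) ≤
          (linkPairs H v B).card + ((3 * n / 4 : ℕ) : ℝ) * (3 * n / 4 : ℕ) := by exact_mod_cast h1
      rw [Nat.cast_sub (by omega), Nat.cast_sub hb] at h2
      push_cast at h2 hmm
      linarith
    nlinarith
  have hwmax : ∀ v ∈ B, (w v : ℝ) ≤ 3 / 10 ^ 4 * (n : ℝ) ^ 2 := fun v hv => by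
    linarith [hw1 v hv, hmax v hv]
  have hwsum : ((∑ v ∈ B, w v : ℕ) : ℝ) ≤ 2 * (n : ℝ) ^ 3 / 10 ^ 10 := by
    push_cast at hsum ⊢
    have h1 := Finset.sum_le_sum hw1
    rw [Finset.sum_add_distrib, Finset.sum_const, nsmul_eq_mul] at h1
    have h2 : (B.card : ℝ) * ((n : ℝ) ^ 2 / 10 ^ 10) ≤ n * ((n : ℝ) ^ 2 / 10 ^ 10) := by
      gcongr
      exact_mod_cast hcard ▸ Finset.card_le_univ B
    have : 0 < (n : ℝ) ^ 3 := by positivity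
    rw [show (n : ℝ) * ((n : ℝ) ^ 2 / 10 ^ 10) = (n : ℝ) ^ 3 / 10 ^ 10 by ring] at h2
    linarith
  have hG : ∀ x ∈ B, ((B.filter fun y =>
      ¬ (x ≠ y ∧ (pairMiss H Bᶜ x y : ℝ) ≤ n / 40)).card : ℝ) ≤ n / 50 := fun x hx => by
    refine card_filter_not_pairMiss_le (by positivity) (hwmax x hx) ?_
    rw [show 3 / 10 ^ 4 * (n : ℝ) ^ 2 / (n / 40) = 12 / 1000 * n by field_simp; norm_num]
    linarith
  have hrich : ∀ v ∉ B, Rich H B v (n / 10 ^ 5) := fun v hv => by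
    refine rich_of_card_linkPairs (lt_of_lt_of_le ?_ (hmin v hv))
    rw [hcard]
    nlinarith
  have hp : HasPartners H Bᶜ B (n / 40) (7 / 10 * n) := hasPartners_of_card_le (by linarith) hG
  set N := B.filter fun v => (w v : ℝ) ≤ (n : ℝ) ^ 2 / 10 ^ 6 with hN
  set V₀ := Bᶜ.filter fun v => (n : ℝ) ^ 2 / 10 ^ 2 < (missPairs H v B).card with hV₀
  obtain ⟨S, hS, hSd, hSl, hSe⟩ := exists_special_segments h3 hcard hn
    (le_trans (by norm_num) hn0) (hB.trans (by linarith))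
    (fun v hv => by
      have := sum_pairMiss_add_le h3 hv (hmiss v)
      omega) hmax hp hrich
  refine exists_loose_cycle_of_special h3 B N V₀ n (le_trans (by norm_num) hn0) (by linarith) hG
    (Finset.filter_subset _ _) ?_ (fun x hx => ?_) hrich ?_ (fun v hv hv' => ?_) S hS hSd hSl hSe
  · have h := card_mul_le_of_le_sum (s := B \ N) (b := (n : ℝ) ^ 2 / 10 ^ 6) Finset.sdiff_subset
      (fun v hv => by
        simp only [hN, Finset.mem_sdiff, Finset.mem_filter, not_and, not_le] at hv
        exact (hv.2 hv.1).le) hwsum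
    refine le_of_mul_le_mul_right (h.trans ?_) (by positivity : 0 < (n : ℝ) ^ 2 / 10 ^ 6)
    have : 0 < (n : ℝ) ^ 3 := by positivity
    rw [show (n : ℝ) / 100 * ((n : ℝ) ^ 2 / 10 ^ 6) = (n : ℝ) ^ 3 / 10 ^ 8 by ring]
    linarith
  · refine card_filter_not_pairMiss_le (by positivity) (Finset.mem_filter.1 hx).2 ?_
    rw [show (n : ℝ) ^ 2 / 10 ^ 6 / (n / 1000) = 1 / 1000 * n by field_simp; norm_num]
    linarith
  · have h := card_mul_le_of_le_sum (s := V₀) (b := (n : ℝ) ^ 2 / 10 ^ 2)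
      (Finset.filter_subset _ _) (fun v hv => (Finset.mem_filter.1 hv).2.le)
      ((congrArg Nat.cast (sum_card_missPairs_compl B)).trans_le hwsum)
    refine le_of_mul_le_mul_right (h.trans ?_) (by positivity : 0 < (n : ℝ) ^ 2 / 10 ^ 2)
    have : 0 < (n : ℝ) ^ 3 := by positivity
    rw [show (n : ℝ) / 10 ^ 7 * ((n : ℝ) ^ 2 / 10 ^ 2) = (n : ℝ) ^ 3 / 10 ^ 9 by ring]
    linarith
  · rw [hV₀, Finset.mem_filter, Finset.mem_compl, not_and, not_lt] at hv'
    refine rich_of_card_missPairs (r := 29 / 100 * n) hv (by linarith) (by linarith)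
      ((hv' hv).trans_lt ?_)
    nlinarith

end Main

/-- The extremal case: a `β`-extremal 3-graph satisfying the exact minimum vertex degree
condition contains a loose Hamilton cycle. -/
theorem stmt_3 :
    ∃ β : ℝ, 0 < β ∧ ∃ n₀ : ℕ, ∀ n : ℕ, n > n₀ → Even n →
      ∀ H : Finset (Finset (Fin n)), (∀ e ∈ H, e.card = 3) →
      (∀ v : Fin n,
        (n - 1).choose 2 - (3 * n / 4).choose 2 + (if 4 ∣ n then 2 else 1) ≤ hdeg H v) →
      BetaExtremal β n H →
      HasLooseHamCycle n H := by
  refine ⟨1 / 10 ^ 18, by norm_num, 10 ^ 20, ?_⟩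
  rintro n hn0 hn H h3 hdeg ⟨B₀, hB₀, hsparse⟩
  have hmiss := fun v => card_missPairs_add_le h3 (Fintype.card_fin n) (hdeg v)
  obtain ⟨B, hB, hmax, hmin, hsum⟩ := exists_stable_set h3 (Fintype.card_fin n) hn0.le hB₀
    (fun v => (Nat.le_add_right _ _).trans (hmiss v)) (by
      have h : ((∑ v ∈ B₀, (linkPairs H v B₀).card : ℕ) : ℝ) ≤ 27 * eIn H B₀ := by
        exact_mod_cast sum_card_linkPairs_le h3 B₀
      have : (0 : ℝ) ≤ (n : ℝ) ^ 3 := by positivity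
      linarith)
  obtain ⟨a, l, hnd, huniv, hl⟩ := exists_loose_cycle_of_stable_set h3 (Fintype.card_fin n) hn
    hn0.le hmiss hB hmax hmin hsum
  refine hasLooseHamCycle_of_list hn hnd ?_ hl
  rw [← List.toFinset_card_of_nodup hnd, huniv, Finset.card_univ, Fintype.card_fin]
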